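/- arXiv:1510.06005 — 2 statements merged into one kernel-verified Lean document; each statement's English description precedes it below -/
import Mathlib

section
/- Fix an integer k ≥ 0, ε > 0 small, and A > 0. Let X be large, w = exp(log X/(log log X)³), R = 2·⌊(log log X)^{3/2}⌋, and let λ_d^+ = μ(d) if ν(d) ≤ R and d | P(w) (and λ_d^+ = 0 otherwise), λ_d^− = μ(d) if ν(d) ≤ R+1 and d | P(w) (and λ_d^− = 0 otherwise). Let R_1, …, R_k ≥ 1 and define a_n = Σ_{p_1⋯p_k | n, R_i ≤ p_i ≤ R_i^{1+ε}} | Σ_{n = p_1⋯p_k·d·m} λ_d^± | (with a fixed choice of sign throughout; for k = 0 read p_1⋯p_k = 1). Then there are constants c_A > 0 and C_k > 0 such that for all T ≥ 1, all x with X ≤ x < 2X, and all y with c_A·x/(log x)^A ≤ y ≤ x: (i) Σ_{x ≤ n ≤ x+y} |a_n|² ≤ C_{A,k}·(log log X)^{C_k}·y/log X, and (ii) Σ_{1 ≤ h ≤ x/T} Σ_{m − n = h, m,n ∈ [x, x+y]} |a_m|·|a_n| ≤ C_{A,k}·(log log X)^{C_k}·(X/T)·y²/(log X)². -/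
open scoped Classical

/-- The primorial `P(w) = ∏_{p < w} p` of all primes below the real number `w`. -/
noncomputable def primorialBelow (w : ℝ) : ℕ :=
  ∏ p ∈ (Finset.range ⌈w⌉₊).filter fun p : ℕ => p.Prime ∧ (p : ℝ) < w, p

/-- The upper bound weights `λ_d⁺` of Brun's pure sieve with truncation `R` and
sieving parameter `w`: `λ_d⁺ = μ(d)` if `ν(d) ≤ R` and `d ∣ P(w)`, else `0`. -/
noncomputable def brunPlus (R : ℕ) (w : ℝ) (d : ℕ) : ℝ :=
  if d.primeFactors.card ≤ R ∧ d ∣ primorialBelow w then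
    ((ArithmeticFunction.moebius d : ℤ) : ℝ) else 0

/-- The lower bound weights `λ_d⁻` of Brun's pure sieve with truncation `R` and
sieving parameter `w`: `λ_d⁻ = μ(d)` if `ν(d) ≤ R + 1` and `d ∣ P(w)`, else `0`. -/
noncomputable def brunMinus (R : ℕ) (w : ℝ) (d : ℕ) : ℝ :=
  if d.primeFactors.card ≤ R + 1 ∧ d ∣ primorialBelow w then
    ((ArithmeticFunction.moebius d : ℤ) : ℝ) else 0

/-- The coefficients `a_n = Σ_{p₁⋯p_k ∣ n, R_i ≤ p_i ≤ R_i^{1+ε}} |Σ_{n = p₁⋯p_k d m} λ_d|`. -/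
noncomputable def sieveCoeff (k : ℕ) (ε : ℝ) (R : Fin k → ℝ) (lam : ℕ → ℝ) (n : ℕ) : ℝ :=
  ∑ p ∈ Fintype.piFinset fun _ : Fin k => Finset.Icc 1 n,
    if (∀ i, (p i).Prime ∧ R i ≤ (p i : ℝ) ∧ (p i : ℝ) ≤ R i ^ (1 + ε)) ∧
        (∏ i, p i) ∣ n then
      |∑ d ∈ (n / ∏ i, p i).divisors, lam d|
    else 0

/-- Squarefree divisors of `n` correspond to sets of primes dividing `n`. -/
lemma sum_squarefree_divisors {M : Type*} [AddCommMonoid M] {n : ℕ} (hn : n ≠ 0) (f : ℕ → M) :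
    ∑ d ∈ n.divisors.filter Squarefree, f d =
      ∑ s ∈ n.primeFactors.powerset, f (∏ p ∈ s, p) := by
  have h := Nat.sum_divisors_filter_squarefree hn (f := f)
  have h2 : (UniqueFactorizationMonoid.normalizedFactors n).toFinset = n.primeFactors := by
    rw [Nat.factors_eq]; ext p; simp
  rw [h2] at h
  convert h using 2 with s
  rw [Finset.prod_val]; rfl

lemma primeFactors_prod_of_subset {n : ℕ} {s : Finset ℕ} (hs : s ⊆ n.primeFactors) :
    (∏ p ∈ s, p).primeFactors = s :=
  Nat.primeFactors_prod fun _ hp => Nat.prime_of_mem_primeFactors (hs hp)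

lemma sum_squarefree_divisors_pow_card {n : ℕ} (hn : n ≠ 0) (c : ℝ) :
    ∑ d ∈ n.divisors.filter Squarefree, c ^ d.primeFactors.card =
      (c + 1) ^ n.primeFactors.card := by
  rw [sum_squarefree_divisors hn, ← Finset.prod_const, Finset.prod_add_one]
  refine Finset.sum_congr rfl fun s hs => ?_
  rw [primeFactors_prod_of_subset (Finset.mem_powerset.1 hs), Finset.prod_const]

lemma primorialBelow_eq (w : ℝ) :
    primorialBelow w = ∏ p ∈ Nat.primesBelow ⌈w⌉₊, p := by
  unfold primorialBelow Nat.primesBelow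
  refine Finset.prod_congr ?_ fun _ _ => rfl
  ext p
  simp only [Finset.mem_filter, Finset.mem_range, Nat.lt_ceil]
  tauto

lemma primeFactors_primorialBelow (w : ℝ) :
    (primorialBelow w).primeFactors = Nat.primesBelow ⌈w⌉₊ := by
  rw [primorialBelow_eq]
  exact Nat.primeFactors_prod fun p hp => Nat.prime_of_mem_primesBelow hp

lemma squarefree_primorialBelow (w : ℝ) : Squarefree (primorialBelow w) := by
  rw [primorialBelow_eq]
  refine Finset.squarefree_prod_of_pairwise_isCoprime (fun p hp q hq hpq => ?_) fun p hp =>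
    (Nat.prime_of_mem_primesBelow hp).squarefree
  exact Nat.coprime_iff_isRelPrime.1 ((Nat.coprime_primes (Nat.prime_of_mem_primesBelow hp)
    (Nat.prime_of_mem_primesBelow hq)).2 hpq)

lemma abs_brunPlus_le (R : ℕ) (w : ℝ) (d : ℕ) :
    |brunPlus R w d| ≤ if Squarefree d then 1 else 0 := by
  unfold brunPlus
  have h : |((ArithmeticFunction.moebius d : ℤ) : ℝ)| ≤ if Squarefree d then 1 else 0 := by
    by_cases hd : Squarefree d
    · rw [if_pos hd]
      exact_mod_cast ArithmeticFunction.abs_moebius_le_one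
    · simp [hd, ArithmeticFunction.moebius_eq_zero_of_not_squarefree hd]
  split_ifs at h ⊢ <;> simp_all

lemma abs_sum_divisors_brunPlus_le (R : ℕ) (w : ℝ) {m : ℕ} (hm : m ≠ 0) :
    |∑ d ∈ m.divisors, brunPlus R w d| ≤ 2 ^ m.primeFactors.card := by
  calc |∑ d ∈ m.divisors, brunPlus R w d| ≤ ∑ d ∈ m.divisors, |brunPlus R w d| :=
        Finset.abs_sum_le_sum_abs _ _
    _ ≤ ∑ d ∈ m.divisors, if Squarefree d then (1 : ℝ) else 0 :=
        Finset.sum_le_sum fun d _ => abs_brunPlus_le R w d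
    _ = ∑ d ∈ m.divisors.filter Squarefree, (1 : ℝ) ^ d.primeFactors.card := by
        rw [Finset.sum_filter]; simp
    _ = 2 ^ m.primeFactors.card := by
        rw [sum_squarefree_divisors_pow_card hm]; norm_num

/-- When `m` has at most `R` prime factors the truncation in the weights is invisible. -/
lemma sum_divisors_brunPlus_of_card_le {R : ℕ} (w : ℝ) {m : ℕ} (hm : m ≠ 0)
    (h : m.primeFactors.card ≤ R) :
    ∑ d ∈ m.divisors, brunPlus R w d = if m.Coprime (primorialBelow w) then 1 else 0 := by
  have hP : primorialBelow w ≠ 0 := (squarefree_primorialBelow w).ne_zero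
  have h1 : ∑ d ∈ m.divisors, brunPlus R w d =
      ∑ d ∈ (m.gcd (primorialBelow w)).divisors, ((ArithmeticFunction.moebius d : ℤ) : ℝ) := by
    symm
    refine Finset.sum_subset_zero_on_sdiff ?_ ?_ ?_
    · exact Nat.divisors_subset_of_dvd hm (Nat.gcd_dvd_left _ _)
    · intro d hd
      rw [Finset.mem_sdiff, Nat.mem_divisors, Nat.mem_divisors] at hd
      unfold brunPlus
      rw [if_neg]
      rintro ⟨-, hdP⟩
      exact hd.2 ⟨Nat.dvd_gcd hd.1.1 hdP, Nat.gcd_ne_zero_left hm⟩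
    · intro d hd
      rw [Nat.mem_divisors] at hd
      unfold brunPlus
      rw [if_pos]
      exact ⟨(Finset.card_le_card (Nat.primeFactors_mono
        (hd.1.trans (Nat.gcd_dvd_left _ _)) hm)).trans h, hd.1.trans (Nat.gcd_dvd_right _ _)⟩
  rw [h1]
  have h2 := congrArg (fun f : ArithmeticFunction ℤ => f (m.gcd (primorialBelow w)))
    ArithmeticFunction.moebius_mul_coe_zeta
  simp only [ArithmeticFunction.coe_mul_zeta_apply,
    ArithmeticFunction.one_apply] at h2
  rw [← Int.cast_sum, h2]
  unfold Nat.Coprime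
  split_ifs <;> simp

/-- The coprimality indicator is at most the upper sieve up to integers with many prime factors. -/
lemma ite_coprime_le (R : ℕ) (w : ℝ) {m : ℕ} (hm : m ≠ 0) :
    (if m.Coprime (primorialBelow w) then (1 : ℝ) else 0) ≤
      ∑ d ∈ m.divisors, brunPlus R w d + 2 * (1 / 2) ^ R * 4 ^ m.primeFactors.card := by
  by_cases h : m.primeFactors.card ≤ R
  · rw [sum_divisors_brunPlus_of_card_le w hm h]
    have : (0 : ℝ) ≤ 2 * (1 / 2) ^ R * 4 ^ m.primeFactors.card := by positivity
    linarith
  · have h1 := (abs_le.1 (abs_sum_divisors_brunPlus_le R w hm)).1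
    have h2 : (1 : ℝ) ≤ 2 ^ m.primeFactors.card := one_le_pow₀ one_le_two
    have h3 : (2 : ℝ) ^ m.primeFactors.card ≤ (1 / 2) ^ R * 4 ^ m.primeFactors.card := by
      have h4 : (4 : ℝ) ^ m.primeFactors.card =
          2 ^ m.primeFactors.card * 2 ^ m.primeFactors.card := by
        rw [← mul_pow]; norm_num
      have h5 : (1 : ℝ) ≤ (1 / 2) ^ R * 2 ^ m.primeFactors.card := by
        rw [one_div, inv_pow, ← div_eq_inv_mul, le_div_iff₀ (by positivity), one_mul]
        exact pow_le_pow_right₀ one_le_two (by omega)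
      rw [h4]
      nlinarith
    have h6 : (if m.Coprime (primorialBelow w) then (1 : ℝ) else 0) ≤ 1 := by
      split_ifs <;> norm_num
    nlinarith

lemma sum_pow_card_primeFactors_div_le (B N : ℕ) :
    ∑ n ∈ Finset.Icc 1 N, (B : ℝ) ^ n.primeFactors.card / n ≤
      (∑ n ∈ Finset.Icc 1 N, (n : ℝ)⁻¹) ^ B := by
  induction B with
  | zero =>
    rw [pow_zero]
    calc ∑ n ∈ Finset.Icc 1 N, ((0 : ℕ) : ℝ) ^ n.primeFactors.card / n
        ≤ ∑ n ∈ Finset.Icc 1 N, if n = 1 then (1 : ℝ) else 0 := by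
          refine Finset.sum_le_sum fun n hn => ?_
          rw [Finset.mem_Icc] at hn
          by_cases h : n = 1
          · simp [h]
          · have : n.primeFactors.card ≠ 0 := by
              simp only [ne_eq, Finset.card_eq_zero, Nat.primeFactors_eq_empty]
              omega
            simp [this, h]
      _ ≤ 1 := by
          rw [Finset.sum_ite_eq']
          split_ifs <;> norm_num
  | succ B ih =>
    calc ∑ n ∈ Finset.Icc 1 N, ((B + 1 : ℕ) : ℝ) ^ n.primeFactors.card / n
        ≤ ∑ n ∈ Finset.Icc 1 N, ∑ de ∈ n.divisorsAntidiagonal,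
            (B : ℝ) ^ de.1.primeFactors.card / de.1 * (de.2 : ℝ)⁻¹ := by
          refine Finset.sum_le_sum fun n hn => ?_
          rw [Finset.mem_Icc] at hn
          have hn0 : n ≠ 0 := by omega
          push_cast
          rw [← sum_squarefree_divisors_pow_card hn0]
          calc (∑ d ∈ n.divisors.filter Squarefree, (B : ℝ) ^ d.primeFactors.card) / n
              ≤ (∑ d ∈ n.divisors, (B : ℝ) ^ d.primeFactors.card) / n := by
                gcongr
                exact Finset.filter_subset _ _
            _ = (∑ de ∈ n.divisorsAntidiagonal, (B : ℝ) ^ de.1.primeFactors.card) / n := by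
                rw [Nat.sum_divisorsAntidiagonal (fun d _ => (B : ℝ) ^ d.primeFactors.card)]
            _ = _ := by
                rw [Finset.sum_div]
                refine Finset.sum_congr rfl fun de hde => ?_
                rw [Nat.mem_divisorsAntidiagonal] at hde
                rw [← hde.1, Nat.cast_mul]
                rw [div_mul_eq_div_div, div_eq_mul_inv]
      _ = ∑ x ∈ (Finset.Icc 1 N).sigma fun n => n.divisorsAntidiagonal,
            (B : ℝ) ^ x.2.1.primeFactors.card / x.2.1 * (x.2.2 : ℝ)⁻¹ :=
          (Finset.sum_sigma' _ _ _)
      _ ≤ ∑ de ∈ Finset.Icc 1 N ×ˢ Finset.Icc 1 N,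
            (B : ℝ) ^ de.1.primeFactors.card / de.1 * (de.2 : ℝ)⁻¹ := by
          have hinj : Set.InjOn (fun x : (_ : ℕ) × (ℕ × ℕ) => x.2)
              ((Finset.Icc 1 N).sigma fun n => n.divisorsAntidiagonal) := by
            rintro ⟨n, de⟩ hx ⟨n', de'⟩ hx' h
            simp only [Finset.coe_sigma, Set.mem_sigma_iff, Finset.mem_coe,
              Nat.mem_divisorsAntidiagonal] at hx hx' h
            subst h
            obtain rfl : n = n' := hx.2.1.symm.trans hx'.2.1
            rfl
          rw [← Finset.sum_image (f := fun de : ℕ × ℕ =>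
            (B : ℝ) ^ de.1.primeFactors.card / de.1 * (de.2 : ℝ)⁻¹) hinj]
          refine Finset.sum_le_sum_of_subset_of_nonneg ?_ fun _ _ _ => by positivity
          intro de hde
          simp only [Finset.mem_image, Finset.mem_sigma, Nat.mem_divisorsAntidiagonal] at hde
          obtain ⟨x, ⟨hx, hx2, hx0⟩, rfl⟩ := hde
          rw [Finset.mem_Icc] at hx
          have h1 : 0 < x.2.1 := Nat.pos_of_ne_zero fun h => hx0 (by rw [← hx2, h, zero_mul])
          have h2 : 0 < x.2.2 := Nat.pos_of_ne_zero fun h => hx0 (by rw [← hx2, h, mul_zero])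
          rw [Finset.mem_product, Finset.mem_Icc, Finset.mem_Icc]
          refine ⟨⟨h1, ?_⟩, h2, ?_⟩ <;> nlinarith
      _ = (∑ n ∈ Finset.Icc 1 N, (B : ℝ) ^ n.primeFactors.card / n) *
            ∑ n ∈ Finset.Icc 1 N, (n : ℝ)⁻¹ := by
          rw [Finset.sum_mul_sum, Finset.sum_product]
      _ ≤ _ := by
          rw [pow_succ]
          gcongr

lemma sum_inv_Icc_le (N : ℕ) : ∑ n ∈ Finset.Icc 1 N, (n : ℝ)⁻¹ ≤ 1 + Real.log N := by
  have h := harmonic_le_one_add_log N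
  rw [harmonic_eq_sum_Icc] at h
  push_cast at h
  exact h

/-- A crude mean value bound for `B ^ ω(n)`. -/
lemma sum_pow_card_primeFactors_le (B : ℕ) {z : ℝ} (Z : ℝ) (hz : 0 ≤ z) (hzZ : z ≤ Z)
    (hZ : 1 ≤ Z) :
    ∑ n ∈ Finset.Icc 1 ⌊z⌋₊, (B : ℝ) ^ n.primeFactors.card ≤ z * (1 + Real.log Z) ^ B := by
  have h1 : ∑ n ∈ Finset.Icc 1 ⌊z⌋₊, (n : ℝ)⁻¹ ≤ 1 + Real.log Z := by
    refine (Finset.sum_le_sum_of_subset_of_nonneg (Finset.Icc_subset_Icc_right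
      (Nat.floor_le_floor hzZ)) fun _ _ _ => by positivity).trans ?_
    refine (sum_inv_Icc_le _).trans ?_
    gcongr
    · exact_mod_cast Nat.floor_pos.2 hZ
    · exact Nat.floor_le (by linarith)
  calc ∑ n ∈ Finset.Icc 1 ⌊z⌋₊, (B : ℝ) ^ n.primeFactors.card
      ≤ ∑ n ∈ Finset.Icc 1 ⌊z⌋₊, z * ((B : ℝ) ^ n.primeFactors.card / n) := by
        refine Finset.sum_le_sum fun n hn => ?_
        rw [Finset.mem_Icc] at hn
        have hn0 : (0 : ℝ) < n := by exact_mod_cast hn.1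
        have hnz : (n : ℝ) ≤ z := (Nat.cast_le.2 hn.2).trans (Nat.floor_le hz)
        rw [mul_div_assoc', le_div_iff₀ hn0, mul_comm]
        gcongr
    _ = z * ∑ n ∈ Finset.Icc 1 ⌊z⌋₊, (B : ℝ) ^ n.primeFactors.card / n := by
        rw [Finset.mul_sum]
    _ ≤ z * (∑ n ∈ Finset.Icc 1 ⌊z⌋₊, (n : ℝ)⁻¹) ^ B := by
        gcongr
        exact sum_pow_card_primeFactors_div_le B _
    _ ≤ _ := by gcongr

/-- Chebyshev-type bound for primes in a dyadic block. -/
lemma sum_inv_primes_dyadic_le {j : ℕ} (hj : 1 ≤ j) :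
    ∑ p ∈ (Finset.Ico (2 ^ j) (2 ^ (j + 1))).filter Nat.Prime, (p : ℝ)⁻¹ ≤ 4 / j := by
  set s := (Finset.Ico (2 ^ j) (2 ^ (j + 1))).filter Nat.Prime with hs
  have h1 : (2 ^ j) ^ s.card ≤ 4 ^ 2 ^ (j + 1) := by
    calc (2 ^ j) ^ s.card ≤ ∏ p ∈ s, p := by
          refine Finset.pow_card_le_prod s (fun p => p) _ fun p hp => ?_
          exact (Finset.mem_Ico.1 (Finset.mem_filter.1 hp).1).1
      _ ≤ primorial (2 ^ (j + 1)) := by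
          unfold primorial
          refine Finset.prod_le_prod_of_subset_of_one_le' ?_ ?_
          · intro p hp
            simp only [hs, Finset.mem_filter, Finset.mem_Ico, Finset.mem_range] at hp ⊢
            exact ⟨by omega, hp.2⟩
          · intro p hp _
            exact (Finset.mem_filter.1 hp).2.one_lt.le
      _ ≤ _ := primorial_le_four_pow _
  have h2 : j * s.card ≤ 4 * 2 ^ j := by
    rw [← pow_mul, show (4 : ℕ) = 2 ^ 2 by norm_num, ← pow_mul] at h1
    have := (Nat.pow_le_pow_iff_right (by norm_num)).1 h1
    rw [pow_succ] at this
    omega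
  have hj0 : (0 : ℝ) < j := by exact_mod_cast hj
  calc ∑ p ∈ s, (p : ℝ)⁻¹ ≤ ∑ p ∈ s, ((2 : ℝ) ^ j)⁻¹ := by
        refine Finset.sum_le_sum fun p hp => ?_
        have := (Finset.mem_Ico.1 (Finset.mem_filter.1 hp).1).1
        gcongr
        exact_mod_cast this
    _ = s.card * ((2 : ℝ) ^ j)⁻¹ := by rw [Finset.sum_const, nsmul_eq_mul]
    _ ≤ 4 / j := by
        rw [← div_eq_mul_inv, div_le_div_iff₀ (by positivity) hj0, mul_comm]
        exact_mod_cast h2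

lemma sum_inv_primes_lt_two_pow_le (J : ℕ) :
    ∑ p ∈ Nat.primesBelow (2 ^ (J + 1)), (p : ℝ)⁻¹ ≤ 4 * ∑ j ∈ Finset.Icc 1 J, (j : ℝ)⁻¹ := by
  induction J with
  | zero =>
    simp
  | succ J ih =>
    rw [Finset.sum_Icc_succ_top (by omega), mul_add]
    have h := sum_inv_primes_dyadic_le (j := J + 1) (by omega)
    have h2 : Nat.primesBelow (2 ^ (J + 1 + 1)) = Nat.primesBelow (2 ^ (J + 1)) ∪
        (Finset.Ico (2 ^ (J + 1)) (2 ^ (J + 1 + 1))).filter Nat.Prime := by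
      have : 2 ^ (J + 1) ≤ 2 ^ (J + 1 + 1) := Nat.pow_le_pow_right (by norm_num) (by omega)
      ext p
      simp only [Nat.mem_primesBelow, Finset.mem_union, Finset.mem_filter, Finset.mem_Ico]
      by_cases hp : p.Prime <;> simp only [hp, and_true, and_false, or_false]
      omega
    rw [h2]
    rw [div_eq_mul_inv] at h
    refine le_trans ?_ (add_le_add ih h)
    rw [← Finset.sum_union_inter]
    exact le_add_of_nonneg_right (Finset.sum_nonneg fun _ _ => by positivity)

lemma sum_inv_primesBelow_le {w : ℝ} (hw : 2 ≤ w) :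
    ∑ p ∈ Nat.primesBelow ⌈w⌉₊, (p : ℝ)⁻¹ ≤ 4 * (1 + Real.log (2 * Real.log w)) := by
  set J := ⌊Real.log w / Real.log 2⌋₊ with hJ
  have hl2 := Real.log_two_gt_d9
  have hlw : Real.log 2 ≤ Real.log w := Real.log_le_log (by norm_num) hw
  have hJ1 : 1 ≤ J := by
    rw [hJ, Nat.one_le_floor_iff, le_div_iff₀ (by linarith)]; linarith
  have hw2 : ⌈w⌉₊ ≤ 2 ^ (J + 1) := by
    rw [Nat.ceil_le]
    have : Real.log w / Real.log 2 < J + 1 := Nat.lt_floor_add_one _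
    rw [div_lt_iff₀ (by linarith)] at this
    push_cast
    rw [← Real.log_le_log_iff (by linarith) (by positivity), Real.log_pow]
    push_cast
    exact this.le
  have hJle : (J : ℝ) ≤ 2 * Real.log w := by
    refine (Nat.floor_le (div_nonneg (by linarith) (by linarith))).trans ?_
    rw [div_le_iff₀ (by linarith)]
    nlinarith
  calc ∑ p ∈ Nat.primesBelow ⌈w⌉₊, (p : ℝ)⁻¹
      ≤ ∑ p ∈ Nat.primesBelow (2 ^ (J + 1)), (p : ℝ)⁻¹ := by
        refine Finset.sum_le_sum_of_subset_of_nonneg ?_ fun _ _ _ => by positivity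
        intro p hp
        rw [Nat.mem_primesBelow] at hp ⊢
        exact ⟨hp.1.trans_le hw2, hp.2⟩
    _ ≤ 4 * ∑ j ∈ Finset.Icc 1 J, (j : ℝ)⁻¹ := sum_inv_primes_lt_two_pow_le J
    _ ≤ 4 * (1 + Real.log J) := by
        gcongr
        exact sum_inv_Icc_le J
    _ ≤ _ := by
        gcongr

lemma prod_primesBelow_one_sub_inv_le {w : ℝ} (hw : 1 < w) :
    ∏ p ∈ Nat.primesBelow ⌈w⌉₊, (1 - (p : ℝ)⁻¹) ≤ 1 / Real.log w := by
  set N := ⌈w⌉₊ with hN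
  let f : ℕ →* ℝ :=
    { toFun := fun n => (n : ℝ)⁻¹, map_one' := by simp, map_mul' := fun a b => by simp [mul_comm] }
  have hf : ∀ {p : ℕ}, p.Prime → ‖f p‖ < 1 := by
    intro p hp
    simp only [f, MonoidHom.coe_mk, OneHom.coe_mk, norm_inv, RCLike.norm_natCast]
    exact inv_lt_one_of_one_lt₀ (by exact_mod_cast hp.one_lt)
  obtain ⟨-, h2⟩ := EulerProduct.summable_and_hasSum_smoothNumbers_prod_primesBelow_geometric hf N
  have hlog : 0 < Real.log w := Real.log_pos hw
  have h3 : Real.log w ≤ ∏ p ∈ Nat.primesBelow N, (1 - (p : ℝ)⁻¹)⁻¹ := by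
    have h4 : ∑ n ∈ Finset.Icc 1 (N - 1), (n : ℝ)⁻¹ ≤
        ∏ p ∈ Nat.primesBelow N, (1 - (p : ℝ)⁻¹)⁻¹ := by
      let e : {n // n ∈ Finset.Icc 1 (N - 1)} ↪ N.smoothNumbers :=
        ⟨fun n => ⟨n.1, Nat.mem_smoothNumbers_of_lt (by have := Finset.mem_Icc.1 n.2; omega)
          (by have := Finset.mem_Icc.1 n.2; omega)⟩,
          fun a b hab => Subtype.ext (congrArg (fun x : N.smoothNumbers => (x : ℕ)) hab)⟩
      have h5 := sum_le_hasSum ((Finset.Icc 1 (N - 1)).attach.map e)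
        (fun i _ => show 0 ≤ f i by simp [f]) h2
      rw [Finset.sum_map] at h5
      rw [← Finset.sum_attach]
      exact h5
    refine le_trans ?_ h4
    have h6 := log_add_one_le_harmonic (N - 1)
    rw [harmonic_eq_sum_Icc] at h6
    push_cast at h6
    refine le_trans ?_ h6
    have hN1 : 1 ≤ N := Nat.one_le_ceil_iff.2 (by linarith)
    rw [Nat.cast_sub hN1]
    refine Real.log_le_log (by linarith) ?_
    push_cast
    linarith [Nat.le_ceil w]
  rw [Finset.prod_inv_distrib] at h3
  rw [one_div]
  exact (le_inv_comm₀ hlog (by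
    by_contra hneg
    have := inv_nonpos.2 (not_lt.1 hneg)
    linarith)).1 h3

lemma abs_card_filter_dvd_sub_le {a b : ℝ} (ha : 0 ≤ a) (hab : a ≤ b) {d : ℕ} (hd : 0 < d) :
    |(((Finset.Icc ⌈a⌉₊ ⌊b⌋₊).filter (d ∣ ·)).card : ℝ) - (b - a) / d| ≤ 1 := by
  have hd0 : (0 : ℝ) < d := by exact_mod_cast hd
  have h1 : (Finset.Icc ⌈a⌉₊ ⌊b⌋₊).filter (d ∣ ·) =
      (Finset.Icc ⌈a / d⌉₊ ⌊b / d⌋₊).map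
        ⟨fun m => d * m, fun _ _ h => Nat.eq_of_mul_eq_mul_left hd h⟩ := by
    ext n
    simp only [Finset.mem_filter, Finset.mem_Icc, Finset.mem_map]
    have hb : 0 ≤ b := ha.trans hab
    have hbd : 0 ≤ b / d := by positivity
    constructor
    · rintro ⟨⟨h1, h2⟩, m, rfl⟩
      rw [Nat.ceil_le] at h1
      rw [Nat.le_floor_iff hb] at h2
      push_cast at h1 h2
      refine ⟨m, ⟨?_, ?_⟩, rfl⟩
      · rw [Nat.ceil_le, div_le_iff₀ hd0]; linarith
      · rw [Nat.le_floor_iff hbd, le_div_iff₀ hd0]; linarith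
    · rintro ⟨m, ⟨h1, h2⟩, hmn⟩
      obtain rfl : d * m = n := hmn
      rw [Nat.ceil_le, div_le_iff₀ hd0] at h1
      rw [Nat.le_floor_iff hbd, le_div_iff₀ hd0] at h2
      refine ⟨⟨?_, ?_⟩, dvd_mul_right _ _⟩
      · rw [Nat.ceil_le]; push_cast; linarith
      · rw [Nat.le_floor_iff hb]; push_cast; linarith
  rw [h1, Finset.card_map, Nat.card_Icc]
  have had : 0 ≤ a / d := by positivity
  have habd : a / d ≤ b / d := by gcongr
  have h2 : ⌈a / d⌉₊ ≤ ⌊b / d⌋₊ + 1 :=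
    (Nat.ceil_mono habd).trans (Nat.ceil_le_floor_add_one _)
  rw [Nat.cast_sub h2, sub_div, abs_le]
  push_cast
  have := Nat.floor_le (had.trans habd)
  have := Nat.lt_floor_add_one (b / d)
  have := Nat.le_ceil (a / d)
  have := Nat.ceil_lt_add_one had
  constructor <;> linarith

lemma sum_abs_brunPlus_le (R : ℕ) {w : ℝ} (hw : 1 ≤ w) :
    ∑ d ∈ (primorialBelow w).divisors, |brunPlus R w d| ≤ w ^ R := by
  have hsub : (primorialBelow w).divisors.filter (fun d => d.primeFactors.card ≤ R) ⊆
      Finset.Icc 1 ⌊w ^ R⌋₊ := by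
    intro d hd
    rw [Finset.mem_filter, Nat.mem_divisors] at hd
    rw [Finset.mem_Icc, Nat.le_floor_iff (by positivity)]
    refine ⟨Nat.pos_of_dvd_of_pos hd.1.1 (Nat.pos_of_ne_zero hd.1.2), ?_⟩
    rw [← Nat.prod_primeFactors_of_squarefree
      ((squarefree_primorialBelow w).squarefree_of_dvd hd.1.1), Nat.cast_prod]
    calc ∏ p ∈ d.primeFactors, (p : ℝ) ≤ ∏ p ∈ d.primeFactors, w := by
          refine Finset.prod_le_prod (fun _ _ => by positivity) fun p hp => ?_
          have hp2 := Nat.primeFactors_mono hd.1.1 hd.1.2 hp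
          rw [primeFactors_primorialBelow, Nat.mem_primesBelow, Nat.lt_ceil] at hp2
          exact hp2.1.le
      _ = w ^ d.primeFactors.card := by rw [Finset.prod_const]
      _ ≤ w ^ R := pow_le_pow_right₀ hw hd.2
  calc ∑ d ∈ (primorialBelow w).divisors, |brunPlus R w d|
      ≤ ∑ d ∈ (primorialBelow w).divisors, if d.primeFactors.card ≤ R then (1 : ℝ) else 0 := by
        refine Finset.sum_le_sum fun d _ => ?_
        by_cases h : d.primeFactors.card ≤ R
        · rw [if_pos h]
          refine (abs_brunPlus_le R w d).trans ?_
          split_ifs <;> norm_num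
        · simp [h, brunPlus]
    _ = (((primorialBelow w).divisors.filter fun d => d.primeFactors.card ≤ R).card : ℝ) := by
        rw [← Finset.sum_filter]; simp
    _ ≤ (Finset.Icc 1 ⌊w ^ R⌋₊).card := by exact_mod_cast Finset.card_le_card hsub
    _ ≤ w ^ R := by
        rw [Nat.card_Icc, Nat.add_sub_cancel]
        exact Nat.floor_le (by positivity)

lemma sum_divisors_primorialBelow {M : Type*} [AddCommMonoid M] (w : ℝ) (f : ℕ → M) :
    ∑ d ∈ (primorialBelow w).divisors, f d =
      ∑ s ∈ (Nat.primesBelow ⌈w⌉₊).powerset, f (∏ p ∈ s, p) := by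
  rw [← Nat.divisors_filter_squarefree_of_squarefree (squarefree_primorialBelow w),
    sum_squarefree_divisors (squarefree_primorialBelow w).ne_zero, primeFactors_primorialBelow]

lemma moebius_prod_primes {s : Finset ℕ} (hs : ∀ p ∈ s, p.Prime) :
    ArithmeticFunction.moebius (∏ p ∈ s, p) = (-1) ^ s.card := by
  rw [ArithmeticFunction.IsMultiplicative.map_prod_of_prime
    ArithmeticFunction.isMultiplicative_moebius s hs, ← Finset.prod_const]
  exact Finset.prod_congr rfl fun p hp => ArithmeticFunction.moebius_apply_prime (hs p hp)

/-- The main term of the sieve is an Euler product, up to the Rankin tail. -/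
lemma sum_brunPlus_div_le (R : ℕ) (w : ℝ) :
    ∑ d ∈ (primorialBelow w).divisors, brunPlus R w d / d ≤
      ∏ p ∈ Nat.primesBelow ⌈w⌉₊, (1 - (p : ℝ)⁻¹) +
        (1 / 2) ^ R * ∏ p ∈ Nat.primesBelow ⌈w⌉₊, (1 + 2 * (p : ℝ)⁻¹) := by
  have h1 : ∏ p ∈ Nat.primesBelow ⌈w⌉₊, (1 - (p : ℝ)⁻¹) =
      ∑ s ∈ (Nat.primesBelow ⌈w⌉₊).powerset, (-1) ^ s.card * ∏ p ∈ s, (p : ℝ)⁻¹ := by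
    simp_rw [sub_eq_add_neg]
    rw [Finset.prod_one_add]
    refine Finset.sum_congr rfl fun s _ => ?_
    rw [← Finset.prod_const, ← Finset.prod_mul_distrib]
    simp
  have h2 : ∏ p ∈ Nat.primesBelow ⌈w⌉₊, (1 + 2 * (p : ℝ)⁻¹) =
      ∑ s ∈ (Nat.primesBelow ⌈w⌉₊).powerset, 2 ^ s.card * ∏ p ∈ s, (p : ℝ)⁻¹ := by
    rw [Finset.prod_one_add]
    refine Finset.sum_congr rfl fun s _ => ?_
    rw [← Finset.prod_const, ← Finset.prod_mul_distrib]
  rw [sum_divisors_primorialBelow w (fun d => brunPlus R w d / d), h1, h2, Finset.mul_sum,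
    ← Finset.sum_add_distrib]
  refine Finset.sum_le_sum fun s hs => ?_
  rw [Finset.mem_powerset] at hs
  have hsp : ∀ p ∈ s, p.Prime := fun p hp => Nat.prime_of_mem_primesBelow (hs hp)
  have hdvd : ∏ p ∈ s, p ∣ primorialBelow w := by
    rw [primorialBelow_eq]
    exact Finset.prod_dvd_prod_of_subset _ _ _ hs
  have hprod : (0 : ℝ) ≤ ∏ p ∈ s, (p : ℝ)⁻¹ := Finset.prod_nonneg fun _ _ => by positivity
  unfold brunPlus
  rw [Nat.primeFactors_prod hsp, moebius_prod_primes hsp, div_eq_mul_inv, Nat.cast_prod,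
    ← Finset.prod_inv_distrib]
  by_cases hR : s.card ≤ R
  · rw [if_pos ⟨hR, hdvd⟩]
    push_cast
    have : (0 : ℝ) ≤ (1 / 2) ^ R * (2 ^ s.card * ∏ p ∈ s, (p : ℝ)⁻¹) := by positivity
    linarith
  · rw [if_neg fun h => hR h.1, zero_mul, ← mul_assoc, ← add_mul]
    refine mul_nonneg ?_ hprod
    have h3 : (-1 : ℝ) ≤ (-1) ^ s.card := by
      rcases neg_one_pow_eq_or ℝ s.card with h | h <;> norm_num [h]
    have h4 : (1 : ℝ) ≤ (1 / 2) ^ R * 2 ^ s.card := by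
      rw [one_div, inv_pow, ← div_eq_inv_mul, le_div_iff₀ (by positivity), one_mul]
      exact pow_le_pow_right₀ one_le_two (by omega)
    linarith

lemma card_coprime_Icc_le (R : ℕ) {w a b : ℝ} (hw : 1 ≤ w) (ha : 0 < a) (hab : a ≤ b) :
    (((Finset.Icc ⌈a⌉₊ ⌊b⌋₊).filter fun m => m.Coprime (primorialBelow w)).card : ℝ) ≤
      (b - a) * ∑ d ∈ (primorialBelow w).divisors, brunPlus R w d / d + w ^ R +
        2 * (1 / 2) ^ R * ∑ m ∈ Finset.Icc 1 ⌊b⌋₊, (4 : ℝ) ^ m.primeFactors.card := by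
  set P := primorialBelow w with hP
  have hP0 : P ≠ 0 := (squarefree_primorialBelow w).ne_zero
  set I := Finset.Icc ⌈a⌉₊ ⌊b⌋₊ with hI
  have hI0 : ∀ m ∈ I, 1 ≤ m := fun m hm =>
    (Nat.one_le_ceil_iff.2 ha).trans (Finset.mem_Icc.1 hm).1
  have h1 : ∀ m ∈ I, ∑ d ∈ m.divisors, brunPlus R w d =
      ∑ d ∈ P.divisors, if d ∣ m then brunPlus R w d else 0 := by
    intro m hm
    have hm0 : m ≠ 0 := by have := hI0 m hm; omega
    rw [← Finset.sum_filter]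
    symm
    refine Finset.sum_subset ?_ ?_
    · intro d hd
      rw [Finset.mem_filter] at hd
      exact Nat.mem_divisors.2 ⟨hd.2, hm0⟩
    · intro d hd hd2
      unfold brunPlus
      rw [if_neg]
      rintro ⟨-, hdP⟩
      exact hd2 (Finset.mem_filter.2 ⟨Nat.mem_divisors.2 ⟨hdP, hP0⟩, Nat.dvd_of_mem_divisors hd⟩)
  calc ((I.filter fun m => m.Coprime P).card : ℝ)
      = ∑ m ∈ I, if m.Coprime P then (1 : ℝ) else 0 := by
        rw [← Finset.sum_filter]; simp
    _ ≤ ∑ m ∈ I, (∑ d ∈ m.divisors, brunPlus R w d +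
          2 * (1 / 2) ^ R * 4 ^ m.primeFactors.card) := by
        refine Finset.sum_le_sum fun m hm => ite_coprime_le R w ?_
        have := hI0 m hm; omega
    _ = ∑ d ∈ P.divisors, brunPlus R w d * ((I.filter (d ∣ ·)).card : ℝ) +
          2 * (1 / 2) ^ R * ∑ m ∈ I, (4 : ℝ) ^ m.primeFactors.card := by
        rw [Finset.sum_add_distrib, ← Finset.mul_sum, Finset.sum_congr rfl h1, Finset.sum_comm]
        congr 1
        refine Finset.sum_congr rfl fun d _ => ?_
        rw [← Finset.sum_filter, Finset.sum_const, nsmul_eq_mul, mul_comm]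
    _ ≤ ∑ d ∈ P.divisors, ((b - a) * (brunPlus R w d / d) + |brunPlus R w d|) +
          2 * (1 / 2) ^ R * ∑ m ∈ Finset.Icc 1 ⌊b⌋₊, (4 : ℝ) ^ m.primeFactors.card := by
        gcongr with d hd
        · have hc := abs_card_filter_dvd_sub_le ha.le hab (Nat.pos_of_mem_divisors hd)
          have h3 : brunPlus R w d * (((I.filter (d ∣ ·)).card : ℝ) - (b - a) / d) ≤
              |brunPlus R w d| := by
            refine (le_abs_self _).trans ?_
            rw [abs_mul]
            exact mul_le_of_le_one_right (abs_nonneg _) hc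
          have h4 : (b - a) * (brunPlus R w d / d) = brunPlus R w d * ((b - a) / d) := by ring
          rw [h4]
          linarith
        · exact fun m hm => Finset.mem_Icc.2 ⟨hI0 m hm, (Finset.mem_Icc.1 hm).2⟩
    _ ≤ _ := by
        rw [Finset.sum_add_distrib, ← Finset.mul_sum]
        gcongr
        exact sum_abs_brunPlus_le R hw

/-- `n` is the product of at most `k` primes below `w` and of an integer free of such primes. -/
def IsAlmostRough (k : ℕ) (w : ℝ) (n : ℕ) : Prop :=
  ∃ q : Fin k → ℕ, (∀ i, q i ∈ insert 1 (Nat.primesBelow ⌈w⌉₊)) ∧ ∏ i, q i ∣ n ∧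
    (n / ∏ i, q i).Coprime (primorialBelow w)

lemma coprime_primorialBelow_of_prime {w : ℝ} {p : ℕ} (hp : p.Prime) (hpw : w ≤ p) :
    p.Coprime (primorialBelow w) := by
  rw [hp.coprime_iff_not_dvd]
  intro h
  have h2 := Nat.mem_primeFactors.2 ⟨hp, h, (squarefree_primorialBelow w).ne_zero⟩
  rw [primeFactors_primorialBelow, Nat.mem_primesBelow, Nat.lt_ceil] at h2
  linarith [h2.1]

lemma isAlmostRough_of_prime_tuple {k : ℕ} {w : ℝ} {n : ℕ} {p : Fin k → ℕ}
    (hn : n ≠ 0) (hp : ∀ i, (p i).Prime) (hdvd : ∏ i, p i ∣ n)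
    (hcop : (n / ∏ i, p i).Coprime (primorialBelow w)) : IsAlmostRough k w n := by
  set q : Fin k → ℕ := fun i => if (p i : ℝ) < w then p i else 1 with hq
  set r : Fin k → ℕ := fun i => if (p i : ℝ) < w then 1 else p i with hr
  have hqr : ∏ i, p i = (∏ i, q i) * ∏ i, r i := by
    rw [← Finset.prod_mul_distrib]
    refine Finset.prod_congr rfl fun i _ => ?_
    simp only [hq, hr]
    split_ifs <;> simp
  obtain ⟨m, rfl⟩ := hdvd
  have hp0 : ∏ i, p i ≠ 0 := left_ne_zero_of_mul hn
  have hq0 : ∏ i, q i ≠ 0 := left_ne_zero_of_mul (hqr ▸ hp0)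
  rw [Nat.mul_div_cancel_left _ (Nat.pos_of_ne_zero hp0)] at hcop
  refine ⟨q, fun i => ?_, ?_, ?_⟩
  · simp only [hq, Finset.mem_insert, Nat.mem_primesBelow, Nat.lt_ceil]
    split_ifs with h
    · exact Or.inr ⟨h, hp i⟩
    · exact Or.inl rfl
  · rw [hqr, mul_assoc]; exact dvd_mul_right _ _
  · rw [hqr, mul_assoc, Nat.mul_div_cancel_left _ (Nat.pos_of_ne_zero hq0)]
    refine Nat.Coprime.mul_left (Nat.Coprime.prod_left fun i _ => ?_) hcop
    simp only [hr]
    split_ifs with h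
    · exact Nat.coprime_one_left _
    · exact coprime_primorialBelow_of_prime (hp i) (not_lt.1 h)

lemma card_isAlmostRough_le (k R : ℕ) {w x y Z V : ℝ} (hw : 1 ≤ w) (hx : 0 < x) (hy : 0 ≤ y)
    (hxZ : x + y ≤ Z) (hZ : 1 ≤ Z)
    (hV : ∑ d ∈ (primorialBelow w).divisors, brunPlus R w d / d ≤ V) :
    (((Finset.Icc ⌈x⌉₊ ⌊x + y⌋₊).filter (IsAlmostRough k w)).card : ℝ) ≤
      (1 + ∑ p ∈ Nat.primesBelow ⌈w⌉₊, (p : ℝ)⁻¹) ^ k *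
        (y * V + 2 * (1 / 2) ^ R * (Z * (1 + Real.log Z) ^ 4)) + w ^ k * w ^ R := by
  set I := Finset.Icc ⌈x⌉₊ ⌊x + y⌋₊ with hI
  set P := primorialBelow w with hP
  set Q := insert 1 (Nat.primesBelow ⌈w⌉₊) with hQ
  set M := y * V + 2 * (1 / 2) ^ R * (Z * (1 + Real.log Z) ^ 4) with hM
  have hQpos : ∀ p ∈ Q, 1 ≤ p := by
    intro p hp
    rcases Finset.mem_insert.1 hp with rfl | hp
    · exact le_rfl
    · exact (Nat.prime_of_mem_primesBelow hp).one_lt.le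
  have hQsum : ∑ p ∈ Q, (p : ℝ)⁻¹ = 1 + ∑ p ∈ Nat.primesBelow ⌈w⌉₊, (p : ℝ)⁻¹ := by
    rw [hQ, Finset.sum_insert (fun h => Nat.not_prime_one (Nat.prime_of_mem_primesBelow h))]
    simp
  have hQcard : (Q.card : ℝ) ≤ w := by
    have hsub : Q ⊆ Finset.Icc 1 ⌊w⌋₊ := by
      intro p hp
      refine Finset.mem_Icc.2 ⟨hQpos p hp, ?_⟩
      rw [Nat.le_floor_iff (by linarith)]
      rcases Finset.mem_insert.1 hp with rfl | hp
      · exact_mod_cast hw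
      · rw [Nat.mem_primesBelow, Nat.lt_ceil] at hp
        exact hp.1.le
    calc (Q.card : ℝ) ≤ (Finset.Icc 1 ⌊w⌋₊).card := by exact_mod_cast Finset.card_le_card hsub
      _ ≤ w := by
        rw [Nat.card_Icc, Nat.add_sub_cancel]
        exact Nat.floor_le (by linarith)
  have hone : ∀ s : ℕ, 1 ≤ s →
      ((I.filter fun n => s ∣ n ∧ (n / s).Coprime P).card : ℝ) ≤ M * (s : ℝ)⁻¹ + w ^ R := by
    intro s hs
    have hs0 : (1 : ℝ) ≤ s := by exact_mod_cast hs
    have hcard : (I.filter fun n => s ∣ n ∧ (n / s).Coprime P).card ≤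
        ((Finset.Icc ⌈x / s⌉₊ ⌊(x + y) / s⌋₊).filter fun m => m.Coprime P).card := by
      refine Finset.card_le_card_of_injOn (fun n => n / s) ?_ ?_
      · intro n hn
        rw [Finset.mem_coe, Finset.mem_filter] at hn
        obtain ⟨hnI, ⟨m, rfl⟩, hcop⟩ := hn
        rw [Nat.mul_div_cancel_left _ hs] at hcop
        rw [hI, Finset.mem_Icc, Nat.ceil_le, Nat.le_floor_iff (by linarith)] at hnI
        push_cast at hnI
        simp only [Finset.coe_filter, Set.mem_ofPred_eq, Finset.mem_Icc,
          Nat.mul_div_cancel_left _ hs]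
        refine ⟨⟨?_, ?_⟩, hcop⟩
        · rw [Nat.ceil_le, div_le_iff₀ (by linarith)]; linarith [hnI.1]
        · rw [Nat.le_floor_iff (by positivity), le_div_iff₀ (by linarith)]; linarith [hnI.2]
      · intro n hn n' hn' h
        rw [Finset.mem_coe, Finset.mem_filter] at hn hn'
        rw [← Nat.div_mul_cancel hn.2.1, ← Nat.div_mul_cancel hn'.2.1]
        exact congrArg (· * s) h
    have h1 := card_coprime_Icc_le R hw (a := x / s) (b := (x + y) / s) (by positivity)
      (by gcongr; linarith)
    have h2 := sum_pow_card_primeFactors_le 4 (z := (x + y) / s) Z (by positivity)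
      ((div_le_self (by linarith) hs0).trans hxZ) hZ
    push_cast at h2
    have h3 : (x + y) / s - x / s = y * (s : ℝ)⁻¹ := by
      rw [← sub_div, add_sub_cancel_left, div_eq_mul_inv]
    rw [h3] at h1
    have hlog : 0 ≤ Real.log Z := Real.log_nonneg hZ
    calc ((I.filter fun n => s ∣ n ∧ (n / s).Coprime P).card : ℝ)
        ≤ ((Finset.Icc ⌈x / s⌉₊ ⌊(x + y) / s⌋₊).filter fun m => m.Coprime P).card := by
          exact_mod_cast hcard
      _ ≤ _ := h1
      _ ≤ y * (s : ℝ)⁻¹ * V + w ^ R +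
            2 * (1 / 2) ^ R * (Z * (s : ℝ)⁻¹ * (1 + Real.log Z) ^ 4) := by
          gcongr
          refine h2.trans ?_
          rw [div_eq_mul_inv]
          gcongr
      _ = M * (s : ℝ)⁻¹ + w ^ R := by rw [hM]; ring
  have hcover : I.filter (IsAlmostRough k w) ⊆
      (Fintype.piFinset fun _ : Fin k => Q).biUnion fun q =>
        I.filter fun n => ∏ i, q i ∣ n ∧ (n / ∏ i, q i).Coprime P := by
    intro n hn
    rw [Finset.mem_filter] at hn
    obtain ⟨hnI, q, hq, hdvd, hcop⟩ := hn
    rw [Finset.mem_biUnion]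
    exact ⟨q, Fintype.mem_piFinset.2 hq, Finset.mem_filter.2 ⟨hnI, hdvd, hcop⟩⟩
  calc ((I.filter (IsAlmostRough k w)).card : ℝ)
      ≤ ∑ q ∈ Fintype.piFinset fun _ : Fin k => Q,
          ((I.filter fun n => ∏ i, q i ∣ n ∧ (n / ∏ i, q i).Coprime P).card : ℝ) := by
        exact_mod_cast (Finset.card_le_card hcover).trans Finset.card_biUnion_le
    _ ≤ ∑ q ∈ Fintype.piFinset fun _ : Fin k => Q, (M * ∏ i, (q i : ℝ)⁻¹ + w ^ R) := by
        refine Finset.sum_le_sum fun q hq => ?_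
        rw [Fintype.mem_piFinset] at hq
        have := hone (∏ i, q i) (Finset.one_le_prod' fun i _ => hQpos _ (hq i))
        rwa [Nat.cast_prod, ← Finset.prod_inv_distrib] at this
    _ = (∑ p ∈ Q, (p : ℝ)⁻¹) ^ k * M + (Q.card : ℝ) ^ k * w ^ R := by
        rw [Finset.sum_add_distrib, ← Finset.mul_sum, Finset.sum_pow', mul_comm,
          Finset.sum_const, Fintype.card_piFinset]
        simp
    _ ≤ _ := by
        rw [hQsum]
        gcongr

lemma sieveCoeff_nonneg (k : ℕ) (ε : ℝ) (Rv : Fin k → ℝ) (lam : ℕ → ℝ) (n : ℕ) :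
    0 ≤ sieveCoeff k ε Rv lam n := by
  unfold sieveCoeff
  refine Finset.sum_nonneg fun p _ => ?_
  split_ifs
  · exact abs_nonneg _
  · exact le_rfl

lemma sieveCoeff_le {k : ℕ} {ε : ℝ} {Rv : Fin k → ℝ} {lam : ℕ → ℝ} {n : ℕ} (hn : n ≠ 0) {B : ℝ}
    (hB : 0 ≤ B) (h : ∀ p : Fin k → ℕ, (∀ i, (p i).Prime) → ∏ i, p i ∣ n →
      |∑ d ∈ (n / ∏ i, p i).divisors, lam d| ≤ B) :
    sieveCoeff k ε Rv lam n ≤ (n.primeFactors.card : ℝ) ^ k * B := by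
  unfold sieveCoeff
  rw [← Finset.sum_filter]
  set T := (Fintype.piFinset fun _ : Fin k => Finset.Icc 1 n).filter fun p =>
    (∀ i, (p i).Prime ∧ Rv i ≤ (p i : ℝ) ∧ (p i : ℝ) ≤ Rv i ^ (1 + ε)) ∧ (∏ i, p i) ∣ n with hT
  have hsub : T ⊆ Fintype.piFinset fun _ : Fin k => n.primeFactors := by
    intro p hp
    rw [hT, Finset.mem_filter] at hp
    rw [Fintype.mem_piFinset]
    intro i
    exact Nat.mem_primeFactors.2 ⟨(hp.2.1 i).1,
      (Finset.dvd_prod_of_mem p (Finset.mem_univ i)).trans hp.2.2, hn⟩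
  have hcard : (T.card : ℝ) ≤ (n.primeFactors.card : ℝ) ^ k := by
    have := Finset.card_le_card hsub
    rw [Fintype.card_piFinset, Finset.prod_const, Finset.card_univ, Fintype.card_fin] at this
    exact_mod_cast this
  calc ∑ p ∈ T, |∑ d ∈ (n / ∏ i, p i).divisors, lam d| ≤ ∑ p ∈ T, B := by
        refine Finset.sum_le_sum fun p hp => ?_
        rw [hT, Finset.mem_filter] at hp
        exact h p (fun i => (hp.2.1 i).1) hp.2.2
    _ = T.card * B := by rw [Finset.sum_const, nsmul_eq_mul]
    _ ≤ _ := by gcongr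

lemma nat_pow_le_factorial_mul_three_pow (m k : ℕ) : (m : ℝ) ^ k ≤ k.factorial * 3 ^ m := by
  have h := Real.pow_div_factorial_le_exp (m : ℝ) (by positivity) k
  rw [div_le_iff₀ (by positivity)] at h
  refine h.trans ?_
  rw [mul_comm, ← Real.exp_one_pow]
  gcongr
  exact Real.exp_one_lt_d9.le.trans (by norm_num)

lemma sieveCoeff_sq_le {k : ℕ} {ε : ℝ} {Rv : Fin k → ℝ} {R R' : ℕ} (hR : R ≤ R') (w : ℝ) {n : ℕ}
    (hn : n ≠ 0) :
    sieveCoeff k ε Rv (brunPlus R' w) n ^ 2 ≤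
      (if IsAlmostRough k w n then (R : ℝ) ^ (2 * k) else 0) +
        (k.factorial : ℝ) ^ 2 * (1 / 2) ^ R * 72 ^ n.primeFactors.card := by
  have hnn := sieveCoeff_nonneg k ε Rv (brunPlus R' w) n
  have hquot : ∀ p : Fin k → ℕ, ∏ i, p i ∣ n → n / ∏ i, p i ≠ 0 ∧
      (n / ∏ i, p i).primeFactors.card ≤ n.primeFactors.card := fun p hp =>
    ⟨(Nat.div_ne_zero_iff_of_dvd hp).2 ⟨hn, fun h => hn (Nat.eq_zero_of_zero_dvd (h ▸ hp))⟩,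
      Finset.card_le_card (Nat.primeFactors_mono (Nat.div_dvd_of_dvd hp) hn)⟩
  have htail : (0 : ℝ) ≤ (k.factorial : ℝ) ^ 2 * (1 / 2) ^ R * 72 ^ n.primeFactors.card := by
    positivity
  by_cases hω : n.primeFactors.card ≤ R
  · have hsum : ∀ p : Fin k → ℕ, ∏ i, p i ∣ n →
        ∑ d ∈ (n / ∏ i, p i).divisors, brunPlus R' w d =
          if (n / ∏ i, p i).Coprime (primorialBelow w) then 1 else 0 := fun p hp =>
      sum_divisors_brunPlus_of_card_le w (hquot p hp).1 (by have := (hquot p hp).2; omega)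
    by_cases hG : IsAlmostRough k w n
    · rw [if_pos hG]
      have h1 : sieveCoeff k ε Rv (brunPlus R' w) n ≤ (n.primeFactors.card : ℝ) ^ k * 1 := by
        refine sieveCoeff_le hn zero_le_one fun p _ hdvd => ?_
        rw [hsum p hdvd]
        split_ifs <;> simp
      have h2 : (n.primeFactors.card : ℝ) ^ k ≤ (R : ℝ) ^ k := by gcongr
      have h3 : sieveCoeff k ε Rv (brunPlus R' w) n ^ 2 ≤ ((R : ℝ) ^ k) ^ 2 := by
        gcongr; linarith
      rw [← pow_mul, mul_comm k 2] at h3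
      linarith
    · have h1 : sieveCoeff k ε Rv (brunPlus R' w) n ≤ (n.primeFactors.card : ℝ) ^ k * 0 := by
        refine sieveCoeff_le hn le_rfl fun p hp hdvd => ?_
        rw [hsum p hdvd, if_neg fun h => hG (isAlmostRough_of_prime_tuple hn hp hdvd h), abs_zero]
      have h2 : sieveCoeff k ε Rv (brunPlus R' w) n = 0 := by linarith
      rw [h2, if_neg hG]
      linarith
  · have h1 : sieveCoeff k ε Rv (brunPlus R' w) n ≤
        (n.primeFactors.card : ℝ) ^ k * 2 ^ n.primeFactors.card := by
      refine sieveCoeff_le hn (by positivity) fun p _ hdvd => ?_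
      refine (abs_sum_divisors_brunPlus_le R' w (hquot p hdvd).1).trans ?_
      exact pow_le_pow_right₀ one_le_two (hquot p hdvd).2
    set t := n.primeFactors.card
    have h2 : (1 : ℝ) ≤ (1 / 2) ^ R * 2 ^ t := by
      rw [one_div, inv_pow, ← div_eq_inv_mul, le_div_iff₀ (by positivity), one_mul]
      exact pow_le_pow_right₀ one_le_two (by omega)
    have h3 : (0 : ℝ) ≤ if IsAlmostRough k w n then (R : ℝ) ^ (2 * k) else 0 := by
      split_ifs <;> positivity
    calc sieveCoeff k ε Rv (brunPlus R' w) n ^ 2 ≤ ((t : ℝ) ^ k * 2 ^ t) ^ 2 := by gcongr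
      _ ≤ ((k.factorial : ℝ) * 3 ^ t * 2 ^ t) ^ 2 := by
          gcongr
          exact nat_pow_le_factorial_mul_three_pow t k
      _ = (k.factorial : ℝ) ^ 2 * 36 ^ t * 1 := by
          rw [show (36 : ℝ) = 3 * 3 * (2 * 2) by norm_num]
          simp only [mul_pow]
          ring
      _ ≤ (k.factorial : ℝ) ^ 2 * 36 ^ t * ((1 / 2) ^ R * 2 ^ t) := by gcongr
      _ = (k.factorial : ℝ) ^ 2 * (1 / 2) ^ R * 72 ^ t := by
          rw [show (72 : ℝ) = 36 * 2 by norm_num, mul_pow]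
          ring
      _ ≤ _ := by linarith

lemma sum_sieveCoeff_sq_le {k : ℕ} {ε : ℝ} {Rv : Fin k → ℝ} {R R' : ℕ} (hR : R ≤ R')
    {w x y Z : ℝ} (hw : 1 < w) (hx : 0 < x) (hy : 0 ≤ y) (hxZ : x + y ≤ Z) (hZ : 1 ≤ Z)
    {S : ℝ} (hS : ∑ p ∈ Nat.primesBelow ⌈w⌉₊, (p : ℝ)⁻¹ ≤ S) :
    ∑ n ∈ Finset.Icc ⌈x⌉₊ ⌊x + y⌋₊, sieveCoeff k ε Rv (brunPlus R' w) n ^ 2 ≤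
      (R : ℝ) ^ (2 * k) * ((1 + S) ^ k * (y * (1 / Real.log w + (1 / 2) ^ R * Real.exp (2 * S)) +
          2 * (1 / 2) ^ R * (Z * (1 + Real.log Z) ^ 4)) + w ^ k * w ^ R) +
        (k.factorial : ℝ) ^ 2 * (1 / 2) ^ R * (Z * (1 + Real.log Z) ^ 72) := by
  set I := Finset.Icc ⌈x⌉₊ ⌊x + y⌋₊ with hI
  have hI0 : ∀ m ∈ I, 1 ≤ m := fun m hm =>
    (Nat.one_le_ceil_iff.2 hx).trans (Finset.mem_Icc.1 hm).1
  have hlog : 0 ≤ Real.log Z := Real.log_nonneg hZ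
  have hlogw : 0 < Real.log w := Real.log_pos hw
  have hV : ∑ d ∈ (primorialBelow w).divisors, brunPlus R w d / d ≤
      1 / Real.log w + (1 / 2) ^ R * Real.exp (2 * S) := by
    refine (sum_brunPlus_div_le R w).trans ?_
    refine add_le_add (prod_primesBelow_one_sub_inv_le hw) ?_
    gcongr
    refine (Real.prod_one_add_le_exp_sum _ fun p => by positivity).trans ?_
    rw [← Finset.mul_sum]
    gcongr
  have hcard := card_isAlmostRough_le k R hw.le hx hy hxZ hZ hV
  have hmom : ∑ n ∈ I, (72 : ℝ) ^ n.primeFactors.card ≤ Z * (1 + Real.log Z) ^ 72 := by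
    have h := sum_pow_card_primeFactors_le 72 (z := x + y) Z (by positivity) hxZ hZ
    push_cast at h
    calc ∑ n ∈ I, (72 : ℝ) ^ n.primeFactors.card
        ≤ ∑ n ∈ Finset.Icc 1 ⌊x + y⌋₊, (72 : ℝ) ^ n.primeFactors.card := by
          refine Finset.sum_le_sum_of_subset_of_nonneg ?_ fun _ _ _ => by positivity
          exact fun m hm => Finset.mem_Icc.2 ⟨hI0 m hm, (Finset.mem_Icc.1 hm).2⟩
      _ ≤ _ := h
      _ ≤ _ := by gcongr
  calc ∑ n ∈ I, sieveCoeff k ε Rv (brunPlus R' w) n ^ 2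
      ≤ ∑ n ∈ I, ((if IsAlmostRough k w n then (R : ℝ) ^ (2 * k) else 0) +
          (k.factorial : ℝ) ^ 2 * (1 / 2) ^ R * 72 ^ n.primeFactors.card) := by
        refine Finset.sum_le_sum fun n hn => sieveCoeff_sq_le hR w ?_
        have := hI0 n hn; omega
    _ = (R : ℝ) ^ (2 * k) * ((I.filter (IsAlmostRough k w)).card : ℝ) +
          (k.factorial : ℝ) ^ 2 * (1 / 2) ^ R * ∑ n ∈ I, (72 : ℝ) ^ n.primeFactors.card := by
        rw [Finset.sum_add_distrib, ← Finset.mul_sum, ← Finset.sum_filter, Finset.sum_const,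
          nsmul_eq_mul, mul_comm]
    _ ≤ _ := by
        gcongr
        exact hcard.trans (by gcongr)

/-- Shifted correlations are controlled by the mean square. -/
lemma sum_correlation_le (a : ℕ → ℝ) {x y H : ℝ} (hH : 0 ≤ H) :
    (∑ h ∈ Finset.Icc 1 ⌊H⌋₊, ∑ n ∈ Finset.Icc ⌈x⌉₊ ⌊x + y⌋₊,
      if ((n + h : ℕ) : ℝ) ≤ x + y then |a (n + h)| * |a n| else 0) ≤
      H * ∑ n ∈ Finset.Icc ⌈x⌉₊ ⌊x + y⌋₊, a n ^ 2 := by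
  set I := Finset.Icc ⌈x⌉₊ ⌊x + y⌋₊ with hI
  have hinner : ∀ h : ℕ, (∑ n ∈ I,
      if ((n + h : ℕ) : ℝ) ≤ x + y then |a (n + h)| * |a n| else 0) ≤ ∑ n ∈ I, a n ^ 2 := by
    intro h
    have hshift : ∑ n ∈ I.filter (fun n => ((n + h : ℕ) : ℝ) ≤ x + y), a (n + h) ^ 2 ≤
        ∑ n ∈ I, a n ^ 2 := by
      rw [← Finset.sum_image (f := fun n => a n ^ 2) (g := fun n => n + h)
        (fun _ _ _ _ e => Nat.add_right_cancel e)]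
      refine Finset.sum_le_sum_of_subset_of_nonneg ?_ fun _ _ _ => sq_nonneg _
      intro m hm
      rw [Finset.mem_image] at hm
      obtain ⟨n, hn, rfl⟩ := hm
      rw [Finset.mem_filter, hI, Finset.mem_Icc] at hn
      rw [hI, Finset.mem_Icc]
      exact ⟨by omega, Nat.le_floor hn.2⟩
    have hbase : ∑ n ∈ I.filter (fun n => ((n + h : ℕ) : ℝ) ≤ x + y), a n ^ 2 ≤
        ∑ n ∈ I, a n ^ 2 :=
      Finset.sum_le_sum_of_subset_of_nonneg (Finset.filter_subset _ _) fun _ _ _ => sq_nonneg _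
    rw [← Finset.sum_filter]
    calc ∑ n ∈ I.filter (fun n => ((n + h : ℕ) : ℝ) ≤ x + y), |a (n + h)| * |a n|
        ≤ ∑ n ∈ I.filter (fun n => ((n + h : ℕ) : ℝ) ≤ x + y),
            (a (n + h) ^ 2 + a n ^ 2) / 2 := by
          refine Finset.sum_le_sum fun n _ => ?_
          rw [← sq_abs (a (n + h)), ← sq_abs (a n)]
          nlinarith [sq_nonneg (|a (n + h)| - |a n|)]
      _ ≤ _ := by
          rw [← Finset.sum_div, Finset.sum_add_distrib]
          linarith
  calc _ ≤ ∑ h ∈ Finset.Icc 1 ⌊H⌋₊, ∑ n ∈ I, a n ^ 2 := Finset.sum_le_sum fun h _ => hinner h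
    _ = (⌊H⌋₊ : ℝ) * ∑ n ∈ I, a n ^ 2 := by
        rw [Finset.sum_const, nsmul_eq_mul, Nat.card_Icc, Nat.add_sub_cancel]
    _ ≤ _ := by
        gcongr
        exact Nat.floor_le hH

lemma mean_square_bound_le (k : ℕ) {ℓ L X y δ W r S G D E F Λ : ℝ} (hℓ : 1 ≤ ℓ) (hL : 1 ≤ L)
    (hy : 0 ≤ y) (hδ : 0 ≤ δ) (hr : 0 ≤ r) (hrℓ : r ≤ 2 * ℓ ^ 2) (hS : 0 ≤ 1 + S)
    (hSℓ : 1 + S ≤ 9 * ℓ) (hG : 1 ≤ G) (hD : 0 ≤ D) (hE : 0 ≤ E) (hF : 0 ≤ F) (hΛ : 0 ≤ Λ)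
    (hΛL : Λ ≤ 2 * L) (hX : X ≤ y * (D * G)) (hδL : δ * (G * L ^ 73) ≤ 1) (hW : W * L ≤ y) :
    r ^ (2 * k) * ((1 + S) ^ k * (y * (1 / (L / ℓ ^ 3) + δ * (E * L ^ 8)) +
        2 * δ * (4 * X * Λ ^ 4)) + W) + F * δ * (4 * X * Λ ^ 72) ≤
      (4 ^ k * (9 ^ k * (1 + E + 128 * D) + 1) + F * (2 ^ 74 * D)) * ℓ ^ (5 * k + 3) *
        (y / L) := by
  have hL0 : 0 < L := by linarith
  have hY : 0 ≤ y / L := by positivity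
  have hyY : y = L * (y / L) := by field_simp
  set Y := y / L with hYdef
  have hsmall : ∀ j : ℕ, j ≤ 73 → δ * (G * L ^ j) ≤ 1 := fun j hj => by
    refine le_trans ?_ hδL
    gcongr
  have hW' : W ≤ Y := by rwa [hYdef, le_div_iff₀ hL0]
  have hℓ3 : 1 ≤ ℓ ^ 3 := one_le_pow₀ hℓ
  have h1 : y * (1 / (L / ℓ ^ 3)) = ℓ ^ 3 * Y := by rw [hYdef]; field_simp
  have h2 : y * (δ * (E * L ^ 8)) ≤ E * Y := by
    calc y * (δ * (E * L ^ 8)) = E * Y * (δ * (1 * L ^ 9)) := by rw [hyY]; ring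
      _ ≤ E * Y * (δ * (G * L ^ 9)) := by gcongr
      _ ≤ E * Y * 1 := by gcongr; exact hsmall 9 (by norm_num)
      _ = _ := mul_one _
  have htail : ∀ j : ℕ, j ≤ 72 → δ * (4 * X * Λ ^ j) ≤ 4 * 2 ^ j * D * Y := fun j hj => by
    calc δ * (4 * X * Λ ^ j) ≤ δ * (4 * (y * (D * G)) * (2 * L) ^ j) := by gcongr
      _ = 4 * 2 ^ j * D * Y * (δ * (G * L ^ (j + 1))) := by
          rw [hyY, mul_pow, pow_succ]; ring
      _ ≤ 4 * 2 ^ j * D * Y * 1 := by gcongr; exact hsmall _ (by omega)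
      _ = _ := mul_one _
  have h3 := htail 4 (by norm_num)
  have h4 := htail 72 (by norm_num)
  have h5 : y * (1 / (L / ℓ ^ 3) + δ * (E * L ^ 8)) + 2 * δ * (4 * X * Λ ^ 4) ≤
      (1 + E + 128 * D) * ℓ ^ 3 * Y := by
    have h6 : (E + 128 * D) * Y * 1 ≤ (E + 128 * D) * Y * ℓ ^ 3 := by gcongr
    rw [mul_add, h1]
    linarith
  have h7 : r ^ (2 * k) ≤ 4 ^ k * ℓ ^ (4 * k) := by
    calc r ^ (2 * k) ≤ (2 * ℓ ^ 2) ^ (2 * k) := by gcongr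
      _ = _ := by rw [mul_pow, ← pow_mul, pow_mul 2 2 k]; norm_num; ring_nf
  calc _ ≤ 4 ^ k * ℓ ^ (4 * k) * ((9 * ℓ) ^ k * ((1 + E + 128 * D) * ℓ ^ 3 * Y) +
          1 * Y) + F * (4 * 2 ^ 72 * D * Y) := by
        have h8 : (1 + S) ^ k * (y * (1 / (L / ℓ ^ 3) + δ * (E * L ^ 8)) +
            2 * δ * (4 * X * Λ ^ 4)) ≤ (9 * ℓ) ^ k * ((1 + E + 128 * D) * ℓ ^ 3 * Y) :=
          (mul_le_mul_of_nonneg_left h5 (by positivity)).trans (by gcongr)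
        rw [mul_assoc F]
        refine add_le_add ((mul_le_mul_of_nonneg_left
          (add_le_add h8 (hW'.trans_eq (one_mul Y).symm)) (by positivity)).trans ?_)
          (mul_le_mul_of_nonneg_left h4 hF)
        gcongr
    _ ≤ 4 ^ k * ℓ ^ (4 * k) * ((9 * ℓ) ^ k * ((1 + E + 128 * D) * ℓ ^ 3 * Y) +
          ℓ ^ (k + 3) * Y) + F * (4 * 2 ^ 72 * D * Y) * ℓ ^ (5 * k + 3) := by
        refine add_le_add ?_ (le_mul_of_one_le_right (by positivity) (one_le_pow₀ hℓ))
        gcongr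
        exact one_le_pow₀ hℓ
    _ = _ := by
        rw [mul_pow, pow_add, pow_add, show 5 * k = 4 * k + k by ring, pow_add]
        ring

open Filter in
lemma eventually_sieve_parameters (k : ℕ) (A : ℝ) :
    ∀ᶠ t : ℝ in atTop, 3 ≤ t ∧ (A + 73) * t ≤ (2 * t ^ ((3 : ℝ) / 2) - 2) * Real.log 2 ∧
      2 * k + 4 * t ^ 2 ≤ t ^ 3 ∧ t ^ 3 ≤ Real.exp t ∧
      2 * (A + (A + 1) * t) ≤ Real.exp t := by
  have h2 : ∀ᶠ t : ℝ in atTop, (A + 73) * t ≤ (2 * t ^ ((3 : ℝ) / 2) - 2) * Real.log 2 := by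
    have hlog : 0 < Real.log 2 := Real.log_pos one_lt_two
    have h := tendsto_rpow_atTop (y := (1 : ℝ) / 2) (by norm_num)
    filter_upwards [h.eventually_ge_atTop (((A + 73) / Real.log 2 + 2) / 2),
      eventually_ge_atTop 1] with t ht ht1
    have h3 : t ^ ((3 : ℝ) / 2) = t * t ^ ((1 : ℝ) / 2) := by
      rw [← Real.rpow_one_add' (by linarith) (by norm_num)]
      norm_num
    have h4 : (A + 73) / Real.log 2 * t ≤ 2 * t ^ ((3 : ℝ) / 2) - 2 := by
      rw [h3]
      nlinarith
    calc (A + 73) * t = (A + 73) / Real.log 2 * t * Real.log 2 := by field_simp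
      _ ≤ _ := by gcongr
  have h4 : ∀ᶠ t : ℝ in atTop, t ^ 3 ≤ Real.exp t := by
    filter_upwards [(Real.tendsto_exp_div_pow_atTop 3).eventually_ge_atTop 1,
      eventually_gt_atTop 0] with t ht ht0
    rwa [le_div_iff₀ (by positivity), one_mul] at ht
  filter_upwards [h2, h4, eventually_ge_atTop (3 : ℝ), eventually_ge_atTop (2 * k + 4 : ℝ),
    eventually_ge_atTop (2 * |A| + 2 * |A + 1|)] with t ht2 ht4 ht3 htk htA
  refine ⟨ht3, ht2, ?_, ht4, le_trans ?_ ht4⟩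
  · have : (0 : ℝ) ≤ k := by positivity
    have ht1 : 1 ≤ t ^ 2 := one_le_pow₀ (by linarith)
    nlinarith [mul_le_mul_of_nonneg_left htk (sq_nonneg t), mul_le_mul_of_nonneg_left ht1 this]
  · have h5 : (2 * |A| + 2 * |A + 1|) * t ≤ t * t := by gcongr
    have h6 : A ≤ |A| * t :=
      (le_abs_self A).trans (le_mul_of_one_le_right (abs_nonneg A) (by linarith))
    have h7 : (A + 1) * t ≤ |A + 1| * t := by gcongr; exact le_abs_self _
    nlinarith [mul_nonneg (mul_self_nonneg t) (show 0 ≤ t - 1 by linarith)]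

lemma sum_sieveCoeff_sq_le_loglog {k : ℕ} {ε A X ℓ : ℝ} {Rv : Fin k → ℝ} {R' : ℕ} (hA : 0 < A)
    (hX1 : 1 < X) (hℓ : ℓ = Real.log (Real.log X)) (hℓ3 : 3 ≤ ℓ)
    (hδ : (A + 73) * ℓ ≤ (2 * ℓ ^ ((3 : ℝ) / 2) - 2) * Real.log 2)
    (hR : 2 * k + 4 * ℓ ^ 2 ≤ ℓ ^ 3) (hexp : ℓ ^ 3 ≤ Real.exp ℓ)
    (hy0 : 2 * (A + (A + 1) * ℓ) ≤ Real.exp ℓ)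
    (hR' : 2 * ⌊ℓ ^ ((3 : ℝ) / 2)⌋₊ ≤ R') {x y : ℝ} (hXx : X ≤ x) (hxX : x < 2 * X)
    (hxy : x / Real.log x ^ A ≤ y) (hyx : y ≤ x) :
    Real.log X ≤ y ∧
    ∑ n ∈ Finset.Icc ⌈x⌉₊ ⌊x + y⌋₊,
      sieveCoeff k ε Rv (brunPlus R' (Real.exp (Real.log X / ℓ ^ 3))) n ^ 2 ≤
        (4 ^ k * (9 ^ k * (1 + Real.exp 8 + 128 * 2 ^ A) + 1) +
          (k.factorial : ℝ) ^ 2 * (2 ^ 74 * 2 ^ A)) * ℓ ^ (5 * k + 3) * (y / Real.log X) := by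
  set L := Real.log X with hLdef
  have hX0 : 0 < X := by linarith
  have hL0 : 0 < L := Real.log_pos hX1
  have hLexp : Real.exp ℓ = L := by rw [hℓ, Real.exp_log hL0]
  have hXexp : Real.exp L = X := Real.exp_log hX0
  rw [hLexp] at hexp hy0
  have hℓ0 : 0 < ℓ := by linarith
  have hℓ27 : 27 ≤ ℓ ^ 3 := by
    calc (27 : ℝ) = 3 ^ 3 := by norm_num
      _ ≤ _ := by gcongr
  have hL27 : 27 ≤ L := hℓ27.trans hexp
  have hlog2 : Real.log 2 ≤ 1 := by linarith [Real.log_two_lt_d9]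
  have hlogx : Real.log x ≤ 2 * L := by
    calc Real.log x ≤ Real.log (2 * X) := Real.log_le_log (by linarith) hxX.le
      _ = Real.log 2 + L := Real.log_mul two_ne_zero hX0.ne'
      _ ≤ _ := by linarith
  have hlogx0 : 0 < Real.log x := hL0.trans_le (Real.log_le_log hX0 hXx)
  have hXy : X ≤ y * (2 ^ A * L ^ A) := by
    rw [← Real.mul_rpow zero_le_two hL0.le, ← div_le_iff₀ (by positivity)]
    refine le_trans ?_ hxy
    gcongr
    linarith
  have hGexp : 2 ^ A * L ^ A * L ≤ Real.exp (L / 2) := by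
    calc (2 : ℝ) ^ A * L ^ A * L = Real.exp (A * Real.log 2 + (A * ℓ + ℓ)) := by
          rw [Real.exp_add, Real.exp_add, hLexp, Real.rpow_def_of_pos two_pos,
            Real.rpow_def_of_pos hL0, ← hℓ, mul_comm A, mul_comm A, mul_assoc]
      _ ≤ _ := by
          gcongr
          have : A * Real.log 2 ≤ A * 1 := by gcongr
          linarith
  have hexpy : Real.exp (L / 2) * L ≤ y := by
    have h1 : Real.exp (L / 2) * Real.exp (L / 2) = X := by
      rw [← Real.exp_add, add_halves, hXexp]
    have h2 : 0 < (2 : ℝ) ^ A * L ^ A := by positivity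
    refine le_of_mul_le_mul_right ?_ h2
    calc Real.exp (L / 2) * L * (2 ^ A * L ^ A) = Real.exp (L / 2) * (2 ^ A * L ^ A * L) := by ring
      _ ≤ Real.exp (L / 2) * Real.exp (L / 2) := by gcongr
      _ ≤ _ := by rwa [h1]
  have hLy : L ≤ y :=
    (le_mul_of_one_le_left hL0.le (Real.one_le_exp (by positivity))).trans hexpy
  refine ⟨hLy, ?_⟩
  set R := 2 * ⌊ℓ ^ ((3 : ℝ) / 2)⌋₊ with hRdef
  have hRle : (R : ℝ) ≤ 2 * ℓ ^ 2 := by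
    have h1 := Nat.floor_le (Real.rpow_nonneg hℓ0.le ((3 : ℝ) / 2))
    have h2 : ℓ ^ ((3 : ℝ) / 2) ≤ ℓ ^ (2 : ℝ) :=
      Real.rpow_le_rpow_of_exponent_le (by linarith) (by norm_num)
    rw [Real.rpow_two] at h2
    rw [hRdef]
    push_cast
    linarith
  have hδL : (1 / 2 : ℝ) ^ R * (L ^ A * L ^ 73) ≤ 1 := by
    have h1 : (1 / 2 : ℝ) ^ R = Real.exp (-(R * Real.log 2)) := by
      rw [Real.exp_neg, Real.exp_nat_mul, Real.exp_log two_pos, one_div, inv_pow]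
    have h2 : L ^ A * L ^ 73 = Real.exp ((A + 73) * ℓ) := by
      rw [← Real.rpow_natCast, ← Real.rpow_add hL0, Real.rpow_def_of_pos hL0, ← hℓ, mul_comm]
      norm_num
    rw [h1, h2, ← Real.exp_add, Real.exp_le_one_iff]
    have h3 := Nat.lt_floor_add_one (ℓ ^ ((3 : ℝ) / 2))
    have h4 : (2 * ℓ ^ ((3 : ℝ) / 2) - 2) * Real.log 2 ≤ R * Real.log 2 := by
      refine mul_le_mul_of_nonneg_right ?_ (Real.log_nonneg one_le_two)
      rw [hRdef]
      push_cast
      linarith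
    linarith
  set w := Real.exp (L / ℓ ^ 3) with hw
  have hlogw : Real.log w = L / ℓ ^ 3 := Real.log_exp _
  have hlogw1 : 1 ≤ L / ℓ ^ 3 := by rwa [le_div_iff₀ (by positivity), one_mul]
  have hw2 : 2 ≤ w := by linarith [Real.add_one_le_exp (L / ℓ ^ 3)]
  have hS : ∑ p ∈ Nat.primesBelow ⌈w⌉₊, (p : ℝ)⁻¹ ≤ 4 * (1 + ℓ) := by
    refine (sum_inv_primesBelow_le hw2).trans ?_
    gcongr
    rw [hlogw]
    refine (Real.log_le_log (y := L) (by positivity) ?_).trans_eq hℓ.symm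
    rw [← mul_div_assoc, div_le_iff₀ (by positivity), mul_comm]
    gcongr
    linarith
  have hW : w ^ k * w ^ R * L ≤ y := by
    refine le_trans ?_ hexpy
    gcongr
    rw [← pow_add, hw, ← Real.exp_nat_mul]
    gcongr
    rw [← mul_div_assoc, div_le_iff₀ (by positivity)]
    push_cast
    nlinarith
  have hΛ : 1 + Real.log (4 * X) ≤ 2 * L := by
    rw [Real.log_mul four_ne_zero hX0.ne', show (4 : ℝ) = 2 * 2 by norm_num,
      Real.log_mul two_ne_zero two_ne_zero]
    linarith
  have hΛ0 : 0 ≤ Real.log (4 * X) := Real.log_nonneg (by linarith)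
  have hy : 0 ≤ y := hL0.le.trans hLy
  have hmain := sum_sieveCoeff_sq_le (k := k) (ε := ε) (Rv := Rv) hR' (w := w) (x := x) (y := y)
    (Z := 4 * X) (by linarith) (by linarith) hy (by linarith) (by linarith) hS
  have hexp8 : Real.exp (2 * (4 * (1 + ℓ))) = Real.exp 8 * L ^ 8 := by
    rw [← hLexp, ← Real.exp_nat_mul, ← Real.exp_add]
    ring_nf
  rw [hexp8, hlogw] at hmain
  exact hmain.trans (mean_square_bound_le k (by linarith) (by linarith) hy (by positivity)
    (by positivity) hRle (by linarith) (by linarith)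
    (Real.one_le_rpow (by linarith) hA.le) (by positivity) (Real.exp_nonneg 8) (by positivity)
    (by linarith) hΛ hXy hδL hW)

/-- Lemma 5: mean value bounds for the sieve-weighted coefficients `a_n`. -/
theorem sieve_coeff_mean_square_bounds (k : ℕ) (ε A : ℝ) (hε : 0 < ε) (hA : 0 < A) :
    ∃ cA : ℝ, 0 < cA ∧ ∃ Ck : ℝ, 0 < Ck ∧ ∃ CAk : ℝ, 0 < CAk ∧
    ∃ X₀ : ℝ, ∀ X : ℝ, X₀ ≤ X →
    ∀ lam : ℕ → ℝ,
      (lam = brunPlus (2 * ⌊Real.log (Real.log X) ^ ((3 : ℝ) / 2)⌋₊)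
          (Real.exp (Real.log X / Real.log (Real.log X) ^ 3)) ∨
       lam = brunMinus (2 * ⌊Real.log (Real.log X) ^ ((3 : ℝ) / 2)⌋₊)
          (Real.exp (Real.log X / Real.log (Real.log X) ^ 3))) →
    ∀ R : Fin k → ℝ, (∀ i, 1 ≤ R i) →
    ∀ T : ℝ, 1 ≤ T →
    ∀ x : ℝ, X ≤ x → x < 2 * X →
    ∀ y : ℝ, cA * x / Real.log x ^ A ≤ y → y ≤ x →
      (∑ n ∈ Finset.Icc ⌈x⌉₊ ⌊x + y⌋₊, |sieveCoeff k ε R lam n| ^ 2)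
          ≤ CAk * Real.log (Real.log X) ^ Ck * y / Real.log X ∧
      (∑ h ∈ Finset.Icc 1 ⌊x / T⌋₊, ∑ n ∈ Finset.Icc ⌈x⌉₊ ⌊x + y⌋₊,
          if ((n + h : ℕ) : ℝ) ≤ x + y then
            |sieveCoeff k ε R lam (n + h)| * |sieveCoeff k ε R lam n| else 0)
          ≤ CAk * Real.log (Real.log X) ^ Ck * (X / T) * y ^ 2 / Real.log X ^ 2 := by
  set C : ℝ := 4 ^ k * (9 ^ k * (1 + Real.exp 8 + 128 * 2 ^ A) + 1) +
    (k.factorial : ℝ) ^ 2 * (2 ^ 74 * 2 ^ A) with hC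
  have hC0 : 0 < C := by positivity
  obtain ⟨X₀, hX₀⟩ := Filter.eventually_atTop.1
    (((Real.tendsto_log_atTop.comp Real.tendsto_log_atTop).eventually
      (eventually_sieve_parameters k A)).and (Filter.eventually_gt_atTop (1 : ℝ)))
  refine ⟨1, one_pos, ((5 * k + 3 : ℕ) : ℝ), by positivity, 2 * C, by positivity, X₀, ?_⟩
  intro X hX lam hlam R _ T hT x hXx hxX y hxy hyx
  obtain ⟨⟨hℓ3, hδ, hR, hexp, hy0⟩, hX1⟩ := hX₀ X hX
  simp only [Function.comp_apply] at hℓ3 hδ hR hexp hy0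
  rw [one_mul] at hxy
  have hlam' : ∃ R', 2 * ⌊Real.log (Real.log X) ^ ((3 : ℝ) / 2)⌋₊ ≤ R' ∧
      lam = brunPlus R' (Real.exp (Real.log X / Real.log (Real.log X) ^ 3)) := by
    rcases hlam with h | h
    · exact ⟨_, le_rfl, h⟩
    · exact ⟨_, Nat.le_succ _, h⟩
  obtain ⟨R', hR', rfl⟩ := hlam'
  obtain ⟨hLy, hsum⟩ := sum_sieveCoeff_sq_le_loglog (ε := ε) (Rv := R) hA hX1 rfl hℓ3 hδ hR hexp
    hy0 hR' hXx hxX hxy hyx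
  rw [← hC] at hsum
  rw [Real.rpow_natCast]
  set L := Real.log X
  set ℓ := Real.log L
  have hL0 : 0 < L := Real.log_pos hX1
  have hX0 : 0 < X := by linarith
  have hℓ0 : 0 < ℓ := by linarith
  have hy : 0 < y := hL0.trans_le hLy
  constructor
  · simp_rw [sq_abs]
    refine hsum.trans ?_
    rw [mul_div_assoc]
    gcongr
    linarith
  · have hH : 0 ≤ x / T := div_nonneg (by linarith) (by linarith)
    have h1 : 1 ≤ y / L := by rwa [one_le_div hL0]
    calc _ ≤ x / T * _ := sum_correlation_le _ hH
      _ ≤ 2 * X / T * (C * ℓ ^ (5 * k + 3) * (y / L) * (y / L)) := by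
          gcongr
          exact hsum.trans (le_mul_of_one_le_right (by positivity) h1)
      _ = _ := by ring
end

section
/- For every δ > 0 there is a constant C_δ such that the following holds. Let T ≥ 3, P ≥ 2, V > 0, and let F(s) = Σ_{p ∼ P} a_p·p^{−s} be a Dirichlet polynomial supported on primes with complex coefficients satisfying |a_p| ≤ 1. Let T' ⊆ [−T, T] be a well-spaced set such that |F(1+it)| ≥ V for every t ∈ T'. Then |T'| ≤ C_δ·T^{2·log(1/V)/log P}·V^{−2}·exp((1+δ)·(log T/log P)·log log T). -/
open scoped Classical

/-- The prime-supported Dirichlet polynomial `F(1+it) = Σ_{p ∼ P} a_p p^{-1-it}`. -/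
noncomputable def primePoly (P : ℝ) (a : ℕ → ℂ) (t : ℝ) : ℂ :=
  ∑ p ∈ Finset.range ⌈2 * P⌉₊,
    if p.Prime ∧ P ≤ (p : ℝ) ∧ (p : ℝ) < 2 * P then
      a p * (p : ℂ) ^ (-(1 + (t : ℂ) * Complex.I))
    else 0

theorem sum_pow_dist_le (S : Finset ℕ) (m : ℕ) {q : ℝ} (hq0 : 0 ≤ q) (hq1 : q < 1) :
    ∑ n ∈ S, q ^ (Nat.dist m n) ≤ 2 * (1 - q)⁻¹ := by
  have key : ∀ A : Finset ℕ, Set.InjOn (Nat.dist m) (A : Set ℕ) →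
      ∑ n ∈ A, q ^ (Nat.dist m n) ≤ (1 - q)⁻¹ := by
    intro A hA
    rw [← Finset.sum_image (f := fun j => q ^ j) hA]
    exact sum_le_hasSum _ (fun _ _ => by positivity) (hasSum_geometric_of_lt_one hq0 hq1)
  rw [← Finset.sum_filter_add_sum_filter_not S (fun n => n ≤ m), two_mul]
  refine add_le_add (key _ ?_) (key _ ?_)
  · intro x hx y hy h
    simp only [Finset.coe_filter, Set.mem_ofPred_eq, Nat.dist] at hx hy h
    omega
  · intro x hx y hy h
    simp only [Finset.coe_filter, Set.mem_ofPred_eq, Nat.dist] at hx hy h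
    omega

theorem sum_exp_neg_sq_le (S : Finset ℕ) (θ : ℕ → ℝ) {N R : ℝ} (hN : 0 < N) (hR : 0 < R)
    (hθ : ∀ m ∈ S, ∀ n ∈ S, |(m : ℝ) - n| / N ≤ |θ m - θ n|) {m : ℕ} (hm : m ∈ S) :
    ∑ n ∈ S, Real.exp (-(R ^ 2 * (θ m - θ n) ^ 2 / 4)) ≤ 2 * Real.exp 1 * (1 + N / R) := by
  set q := Real.exp (-(R / N)) with hq
  have hx : 0 < R / N := by positivity
  have hq1 : q < 1 := by rw [hq, Real.exp_lt_one_iff]; linarith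
  have hinv : (1 - q)⁻¹ ≤ 1 + N / R := by
    have h1 : 1 + R / N ≤ Real.exp (R / N) := by linarith [Real.add_one_le_exp (R / N)]
    have h2 : q ≤ (1 + R / N)⁻¹ := by
      rw [hq, Real.exp_neg]
      exact inv_anti₀ (by positivity) h1
    have h3 : (1 + N / R)⁻¹ ≤ 1 - q := by
      have : (1 + N / R)⁻¹ = 1 - (1 + R / N)⁻¹ := by
        have : N + R ≠ 0 := by positivity
        have : R + N ≠ 0 := by positivity
        field_simp
        ring
      linarith
    exact inv_le_of_inv_le₀ (by positivity) h3
  calc ∑ n ∈ S, Real.exp (-(R ^ 2 * (θ m - θ n) ^ 2 / 4))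
      ≤ ∑ n ∈ S, Real.exp 1 * q ^ (Nat.dist m n) := by
        refine Finset.sum_le_sum fun n hn => ?_
        rw [hq, ← Real.exp_nat_mul, ← Real.exp_add]
        apply Real.exp_le_exp.2
        have hd : ((Nat.dist m n : ℕ) : ℝ) = |(m : ℝ) - n| := by
          rcases le_total m n with h | h
          · rw [Nat.dist_eq_sub_of_le h, Nat.cast_sub h, abs_of_nonpos] <;>
              linarith [(Nat.cast_le (α := ℝ)).2 h]
          · rw [Nat.dist_eq_sub_of_le_right h, Nat.cast_sub h, abs_of_nonneg]
            linarith [(Nat.cast_le (α := ℝ)).2 h]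
        have h := hθ m hm n hn
        rw [hd]
        have h2 : |(m : ℝ) - n| * (R / N) ≤ R * |θ m - θ n| := by
          calc _ = R * (|(m : ℝ) - n| / N) := by ring
            _ ≤ _ := by gcongr
        have h3 : R ^ 2 * (θ m - θ n) ^ 2 = (R * |θ m - θ n|) ^ 2 := by
          rw [mul_pow, sq_abs]
        rw [h3]
        nlinarith [sq_nonneg (R * |θ m - θ n| - 2)]
    _ = Real.exp 1 * ∑ n ∈ S, q ^ (Nat.dist m n) := by rw [Finset.mul_sum]
    _ ≤ Real.exp 1 * (2 * (1 - q)⁻¹) := by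
        gcongr
        exact sum_pow_dist_le S m (by positivity) hq1
    _ ≤ Real.exp 1 * (2 * (1 + N / R)) := by gcongr
    _ = _ := by ring


/-- The finite trigonometric sum with frequencies `θ n`. -/
noncomputable def trigSum (S : Finset ℕ) (c : ℕ → ℂ) (θ : ℕ → ℝ) (u : ℝ) : ℂ :=
  ∑ n ∈ S, c n * Complex.exp (Complex.I * θ n * u)

theorem continuous_trigSum (S : Finset ℕ) (c : ℕ → ℂ) (θ : ℕ → ℝ) :
    Continuous (trigSum S c θ) := by
  unfold trigSum
  fun_prop

theorem norm_trigSum_le (S : Finset ℕ) (c : ℕ → ℂ) (θ : ℕ → ℝ) (u : ℝ) :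
    ‖trigSum S c θ u‖ ≤ ∑ n ∈ S, ‖c n‖ := by
  refine (norm_sum_le _ _).trans (Finset.sum_le_sum fun n _ => ?_)
  rw [norm_mul, show Complex.I * θ n * u = ((θ n * u : ℝ) : ℂ) * Complex.I by push_cast; ring,
    Complex.norm_exp_ofReal_mul_I, mul_one]

theorem hasDerivAt_trigSum (S : Finset ℕ) (c : ℕ → ℂ) (θ : ℕ → ℝ) (u : ℝ) :
    HasDerivAt (trigSum S c θ) (trigSum S (fun n => c n * (Complex.I * θ n)) θ u) u := by
  unfold trigSum
  refine HasDerivAt.fun_sum fun n _ => ?_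
  have h : HasDerivAt (fun u : ℝ => Complex.I * θ n * (u : ℂ)) (Complex.I * θ n) u := by
    simpa using (Complex.ofRealCLM.hasDerivAt (x := u)).const_mul (Complex.I * (θ n : ℂ))
  convert! h.cexp.const_mul (c n) using 1
  ring

theorem integrable_gaussian_mul_trigSum_sq (S : Finset ℕ) (c : ℕ → ℂ) (θ : ℕ → ℝ) {R : ℝ}
    (hR : 0 < R) :
    MeasureTheory.Integrable
      (fun u : ℝ => Real.exp (-(R ^ 2)⁻¹ * u ^ 2) * ‖trigSum S c θ u‖ ^ 2) := by
  refine (integrable_exp_neg_mul_sq (b := (R ^ 2)⁻¹) (by positivity)).mul_bdd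
    (c := (∑ n ∈ S, ‖c n‖) ^ 2) ?_ ?_
  · exact ((continuous_trigSum S c θ).norm.pow 2).aestronglyMeasurable
  · filter_upwards with u
    rw [Real.norm_of_nonneg (by positivity)]
    gcongr
    exact norm_trigSum_le S c θ u

theorem integral_cexp_mul_gaussian {R : ℝ} (hR : 0 < R) (x : ℝ) :
    ∫ u : ℝ, Complex.exp (Complex.I * x * u) * Complex.exp (-((R : ℂ) ^ 2)⁻¹ * u ^ 2) =
      ((√Real.pi * R * Real.exp (-(R ^ 2 * x ^ 2 / 4)) : ℝ) : ℂ) := by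
  have hb : 0 < (((R : ℂ) ^ 2)⁻¹).re := by
    rw [← Complex.ofReal_pow, ← Complex.ofReal_inv, Complex.ofReal_re]
    positivity
  rw [fourierIntegral_gaussian hb]
  have h1 : (Real.pi / ((R : ℂ) ^ 2)⁻¹ : ℂ) = ((Real.pi * R ^ 2 : ℝ) : ℂ) := by
    push_cast
    field_simp
  have h2 : (1 / 2 : ℂ) = ((1 / 2 : ℝ) : ℂ) := by push_cast; rfl
  rw [h1, h2, ← Complex.ofReal_cpow (by positivity), ← Real.sqrt_eq_rpow,
    Real.sqrt_mul (by positivity), Real.sqrt_sq hR.le]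
  push_cast
  congr 2
  have : (R : ℂ) ≠ 0 := by exact_mod_cast hR.ne'
  field_simp

theorem gaussian_mul_trigSum_sq (S : Finset ℕ) (c : ℕ → ℂ) (θ : ℕ → ℝ) (R u : ℝ) :
    ((Real.exp (-(R ^ 2)⁻¹ * u ^ 2) * ‖trigSum S c θ u‖ ^ 2 : ℝ) : ℂ) =
      ∑ m ∈ S, ∑ n ∈ S, c m * (starRingEnd ℂ) (c n) *
        (Complex.exp (Complex.I * (θ m - θ n : ℝ) * u) *
          Complex.exp (-((R : ℂ) ^ 2)⁻¹ * u ^ 2)) := by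
  have h : ((‖trigSum S c θ u‖ ^ 2 : ℝ) : ℂ) =
      trigSum S c θ u * (starRingEnd ℂ) (trigSum S c θ u) := by
    rw [Complex.mul_conj, Complex.normSq_eq_norm_sq]
  rw [Complex.ofReal_mul, h]
  unfold trigSum
  rw [map_sum, Finset.sum_mul_sum, Finset.mul_sum]
  refine Finset.sum_congr rfl fun m _ => ?_
  rw [Finset.mul_sum]
  refine Finset.sum_congr rfl fun n _ => ?_
  have e : Complex.exp (Complex.I * (θ m - θ n : ℝ) * u) =
      Complex.exp (Complex.I * θ m * u) * Complex.exp (-Complex.I * θ n * u) := by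
    rw [← Complex.exp_add]
    congr 1
    push_cast
    ring
  rw [e, map_mul, ← Complex.exp_conj]
  simp only [map_mul, Complex.conj_I, Complex.conj_ofReal]
  push_cast
  ring

/-- A mean value estimate with Gaussian weight for trigonometric sums with separated
frequencies. -/
theorem integral_gaussian_mul_trigSum_sq_le (S : Finset ℕ) (c : ℕ → ℂ) (θ : ℕ → ℝ) {N R : ℝ}
    (hN : 0 < N) (hR : 0 < R)
    (hθ : ∀ m ∈ S, ∀ n ∈ S, |(m : ℝ) - n| / N ≤ |θ m - θ n|) :
    ∫ u : ℝ, Real.exp (-(R ^ 2)⁻¹ * u ^ 2) * ‖trigSum S c θ u‖ ^ 2 ≤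
      2 * √Real.pi * Real.exp 1 * (R + N) * ∑ n ∈ S, ‖c n‖ ^ 2 := by
  set E : ℕ → ℕ → ℝ := fun m n => Real.exp (-(R ^ 2 * (θ m - θ n) ^ 2 / 4)) with hE
  have hintegrable : ∀ x : ℝ, MeasureTheory.Integrable (fun u : ℝ =>
      Complex.exp (Complex.I * x * u) * Complex.exp (-((R : ℂ) ^ 2)⁻¹ * u ^ 2)) := by
    intro x
    have hb : 0 < (((R : ℂ) ^ 2)⁻¹).re := by
      rw [← Complex.ofReal_pow, ← Complex.ofReal_inv, Complex.ofReal_re]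
      positivity
    refine (integrable_cexp_neg_mul_sq hb).bdd_mul (c := 1) ?_ ?_
    · exact (by fun_prop : Continuous fun u : ℝ =>
        Complex.exp (Complex.I * x * u)).aestronglyMeasurable
    · filter_upwards with u
      rw [show Complex.I * x * u = ((x * u : ℝ) : ℂ) * Complex.I by push_cast; ring,
        Complex.norm_exp_ofReal_mul_I]
  have hI : ((∫ u : ℝ, Real.exp (-(R ^ 2)⁻¹ * u ^ 2) * ‖trigSum S c θ u‖ ^ 2 : ℝ) : ℂ) =
      ∑ m ∈ S, ∑ n ∈ S, c m * (starRingEnd ℂ) (c n) * ((√Real.pi * R * E m n : ℝ) : ℂ) := by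
    rw [← integral_complex_ofReal]
    simp_rw [gaussian_mul_trigSum_sq]
    rw [MeasureTheory.integral_finsetSum]
    · refine Finset.sum_congr rfl fun m _ => ?_
      rw [MeasureTheory.integral_finsetSum]
      · refine Finset.sum_congr rfl fun n _ => ?_
        rw [MeasureTheory.integral_const_mul, integral_cexp_mul_gaussian hR]
      · exact fun n _ => (hintegrable _).const_mul _
    · exact fun m _ => MeasureTheory.integrable_finsetSum _ fun n _ => (hintegrable _).const_mul _
  have hsymm : ∀ m n, E m n = E n m := fun m n => by
    simp only [hE]
    congr 3
    ring
  calc ∫ u : ℝ, Real.exp (-(R ^ 2)⁻¹ * u ^ 2) * ‖trigSum S c θ u‖ ^ 2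
      ≤ ‖((∫ u : ℝ, Real.exp (-(R ^ 2)⁻¹ * u ^ 2) * ‖trigSum S c θ u‖ ^ 2 : ℝ) : ℂ)‖ := by
        rw [Complex.norm_real]
        exact Real.le_norm_self _
    _ ≤ ∑ m ∈ S, ∑ n ∈ S, √Real.pi * R * (‖c m‖ ^ 2 / 2 * E m n + ‖c n‖ ^ 2 / 2 * E n m) := by
        rw [hI]
        refine (norm_sum_le _ _).trans (Finset.sum_le_sum fun m _ => ?_)
        refine (norm_sum_le _ _).trans (Finset.sum_le_sum fun n _ => ?_)
        rw [norm_mul, norm_mul, RCLike.norm_conj, Complex.norm_real,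
          Real.norm_of_nonneg (by positivity), hsymm n m]
        have h1 : ‖c m‖ * ‖c n‖ ≤ ‖c m‖ ^ 2 / 2 + ‖c n‖ ^ 2 / 2 := by
          nlinarith [sq_nonneg (‖c m‖ - ‖c n‖)]
        have h2 : 0 ≤ √Real.pi * R * E m n := by positivity
        calc _ ≤ (‖c m‖ ^ 2 / 2 + ‖c n‖ ^ 2 / 2) * (√Real.pi * R * E m n) := by gcongr
          _ = _ := by ring
    _ = √Real.pi * R * ∑ m ∈ S, ‖c m‖ ^ 2 * ∑ n ∈ S, E m n := by
        simp_rw [← Finset.mul_sum, Finset.sum_add_distrib]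
        rw [Finset.sum_comm (f := fun x i => ‖c i‖ ^ 2 / 2 * E i x), ← Finset.sum_add_distrib]
        congr 1
        refine Finset.sum_congr rfl fun m _ => ?_
        rw [← Finset.mul_sum]
        ring
    _ ≤ √Real.pi * R * ∑ m ∈ S, ‖c m‖ ^ 2 * (2 * Real.exp 1 * (1 + N / R)) := by
        gcongr with m hm
        exact sum_exp_neg_sq_le S θ hN hR hθ hm
    _ = _ := by
        rw [← Finset.sum_mul]
        field_simp

theorem le_integral_add_abs_deriv {g g' : ℝ → ℝ} (hg : ∀ u, HasDerivAt g (g' u) u)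
    (hg' : Continuous g') (t : ℝ) :
    g t ≤ ∫ u in Set.Ioc (t - 1 / 2) (t + 1 / 2), (g u + |g' u|) := by
  have hgc : Continuous g := continuous_iff_continuousAt.2 fun u => (hg u).continuousAt
  set I := Set.Ioc (t - 1 / 2) (t + 1 / 2) with hI
  have hi : ∀ {f : ℝ → ℝ}, Continuous f → MeasureTheory.IntegrableOn f I := fun hf =>
    (hf.continuousOn.integrableOn_Icc (a := t - 1 / 2) (b := t + 1 / 2)).mono_set
      Set.Ioc_subset_Icc_self
  have hle : ∀ u ∈ I, g t ≤ g u + ∫ v in I, |g' v| := by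
    intro u hu
    have h := intervalIntegral.integral_eq_sub_of_hasDerivAt (fun x _ => hg x)
      (hg'.intervalIntegrable u t)
    have h1 : ‖∫ v in u..t, g' v‖ ≤ ∫ v in Set.uIoc u t, ‖g' v‖ :=
      intervalIntegral.norm_integral_le_integral_norm_uIoc
    have h2 : ∫ v in Set.uIoc u t, ‖g' v‖ ≤ ∫ v in I, ‖g' v‖ := by
      refine MeasureTheory.setIntegral_mono_set (hi hg'.norm)
        (Filter.Eventually.of_forall fun _ => norm_nonneg _) (Filter.Eventually.of_forall ?_)
      intro x hx
      rcases Set.mem_uIoc.1 hx with h | h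
      · exact ⟨hu.1.trans h.1, by linarith [h.2]⟩
      · exact ⟨by linarith [h.1], h.2.trans hu.2⟩
    rw [h] at h1
    have h3 := Real.le_norm_self (g t - g u)
    simp only [Real.norm_eq_abs] at h1 h2 h3
    linarith
  have hvol : MeasureTheory.volume.real I = 1 := by
    rw [hI, Real.volume_real_Ioc_of_le (by linarith)]
    ring
  have hfin : MeasureTheory.volume I ≠ ⊤ := by
    rw [hI]
    exact measure_Ioc_lt_top.ne
  have h4 : ∫ _ in I, g t ≤ ∫ u in I, (g u + ∫ v in I, |g' v|) :=
    MeasureTheory.setIntegral_mono_on (MeasureTheory.integrableOn_const hfin)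
      (hi (by fun_prop)) measurableSet_Ioc hle
  rw [MeasureTheory.integral_add (hi hgc) (MeasureTheory.integrableOn_const hfin),
    MeasureTheory.setIntegral_const, MeasureTheory.setIntegral_const, hvol, one_smul,
    one_smul] at h4
  rwa [MeasureTheory.integral_add (hi hgc) (hi hg'.abs)]

/-- A discrete mean value estimate over well-spaced points for trigonometric sums with separated
frequencies of size at most `W`. -/
theorem sum_trigSum_sq_le (S : Finset ℕ) (c : ℕ → ℂ) (θ : ℕ → ℝ) {N R W : ℝ}
    (hN : 0 < N) (hR : 0 < R) (hW : 0 < W)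
    (hθ : ∀ m ∈ S, ∀ n ∈ S, |(m : ℝ) - n| / N ≤ |θ m - θ n|)
    (hθW : ∀ n ∈ S, |θ n| ≤ W) (T' : Finset ℝ) (hT : ∀ t ∈ T', |t| + 1 / 2 ≤ R)
    (hsep : ∀ t ∈ T', ∀ u ∈ T', t ≠ u → 1 ≤ |t - u|) :
    ∑ t ∈ T', ‖trigSum S c θ t‖ ^ 2 ≤
      2 * √Real.pi * Real.exp 1 ^ 2 * (1 + 2 * W) * (R + N) * ∑ n ∈ S, ‖c n‖ ^ 2 := by
  set c' : ℕ → ℂ := fun n => c n * (Complex.I * θ n) with hc'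
  set f := trigSum S c θ with hf
  set f' := trigSum S c' θ with hf'
  have hfc : Continuous f := continuous_trigSum S c θ
  have hfc' : Continuous f' := continuous_trigSum S c' θ
  set G : ℝ → ℝ := fun u => Real.exp (-(R ^ 2)⁻¹ * u ^ 2) with hG
  set h : ℝ → ℝ := fun u => (1 + W) * ‖f u‖ ^ 2 + W⁻¹ * ‖f' u‖ ^ 2 with hh
  have hhc : Continuous h := by fun_prop
  have hh0 : ∀ u, 0 ≤ h u := fun u => by positivity
  let I : ℝ → Set ℝ := fun t => Set.Ioc (t - 1 / 2) (t + 1 / 2)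
  have hi : ∀ {g : ℝ → ℝ}, Continuous g → ∀ t, MeasureTheory.IntegrableOn g (I t) := fun hg t =>
    (hg.continuousOn.integrableOn_Icc (a := t - 1 / 2) (b := t + 1 / 2)).mono_set
      Set.Ioc_subset_Icc_self
  have hpt : ∀ t, ‖f t‖ ^ 2 ≤ ∫ u in I t, h u := by
    intro t
    have hd : ∀ u, HasDerivAt (fun u => ‖f u‖ ^ 2) (2 * inner ℝ (f u) (f' u)) u := fun u =>
      (hasDerivAt_trigSum S c θ u).norm_sq
    have hdc : Continuous fun u => 2 * inner ℝ (f u) (f' u) :=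
      continuous_const.mul (hfc.inner hfc')
    refine (le_integral_add_abs_deriv hd hdc t).trans ?_
    refine MeasureTheory.setIntegral_mono (hi (by fun_prop) t) (hi hhc t) fun u => ?_
    have h1 : |inner ℝ (f u) (f' u)| ≤ ‖f u‖ * ‖f' u‖ := abs_real_inner_le_norm _ _
    have h2 : 2 * (‖f u‖ * ‖f' u‖) ≤ W * ‖f u‖ ^ 2 + W⁻¹ * ‖f' u‖ ^ 2 := by
      have h3 : 0 ≤ W⁻¹ * (W * ‖f u‖ - ‖f' u‖) ^ 2 := by positivity
      have h4 : W⁻¹ * (W * ‖f u‖ - ‖f' u‖) ^ 2 =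
          W * ‖f u‖ ^ 2 + W⁻¹ * ‖f' u‖ ^ 2 - 2 * (‖f u‖ * ‖f' u‖) := by
        field_simp
        ring
      linarith
    simp only [hh, abs_mul, abs_two]
    linarith
  have hintegrable := integrable_gaussian_mul_trigSum_sq S c θ hR
  have hintegrable' := integrable_gaussian_mul_trigSum_sq S c' θ hR
  have hGh : (fun u => Real.exp 1 * (G u * h u)) = fun u =>
      Real.exp 1 * ((1 + W) * (G u * ‖f u‖ ^ 2) + W⁻¹ * (G u * ‖f' u‖ ^ 2)) := by
    ext u
    simp only [hh]
    ring
  have hGi : MeasureTheory.Integrable fun u => Real.exp 1 * (G u * h u) := by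
    rw [hGh]
    exact ((hintegrable.const_mul _).add (hintegrable'.const_mul _)).const_mul _
  have hGe : ∀ u ∈ ⋃ t ∈ T', I t, h u ≤ Real.exp 1 * (G u * h u) := by
    intro u hu
    obtain ⟨t, ht, hut⟩ := Set.mem_iUnion₂.1 hu
    have hu' : |u| ≤ R := by
      have h1 := hT t ht
      have h2 := abs_le.1 (show |t| ≤ R - 1 / 2 by linarith)
      exact abs_le.2 ⟨by linarith [hut.1, h2.1], by linarith [hut.2, h2.2]⟩
    have h1 : 1 ≤ Real.exp 1 * G u := by
      rw [hG, ← Real.exp_add, Real.one_le_exp_iff]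
      have : (R ^ 2)⁻¹ * u ^ 2 ≤ 1 := by
        rw [inv_mul_le_iff₀ (by positivity), mul_one]
        exact sq_le_sq.2 (hu'.trans (le_abs_self R))
      linarith
    calc h u = 1 * h u := by ring
      _ ≤ Real.exp 1 * G u * h u := by gcongr
      _ = _ := by ring
  have hdisj : Set.Pairwise (T' : Set ℝ) (Function.onFun Disjoint I) := by
    intro t ht u hu htu
    refine Set.disjoint_left.2 fun x hx hy => ?_
    have h1 := hsep t ht u hu htu
    have h2 : |t - u| < 1 := abs_lt.2 ⟨by linarith [hx.2, hy.1], by linarith [hx.1, hy.2]⟩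
    linarith
  have hmeas : MeasurableSet (⋃ t ∈ T', I t) :=
    T'.measurableSet_biUnion fun _ _ => measurableSet_Ioc
  have hc2 : ∑ n ∈ S, ‖c' n‖ ^ 2 ≤ W ^ 2 * ∑ n ∈ S, ‖c n‖ ^ 2 := by
    rw [Finset.mul_sum]
    refine Finset.sum_le_sum fun n hn => ?_
    simp only [hc', norm_mul, Complex.norm_I, one_mul, Complex.norm_real, Real.norm_eq_abs]
    rw [mul_pow, mul_comm]
    have := hθW n hn
    gcongr
  have hM := integral_gaussian_mul_trigSum_sq_le S c θ hN hR hθ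
  have hM' := integral_gaussian_mul_trigSum_sq_le S c' θ hN hR hθ
  set K := 2 * √Real.pi * Real.exp 1 * (R + N) with hK
  have hK0 : 0 ≤ K := by positivity
  calc ∑ t ∈ T', ‖f t‖ ^ 2 ≤ ∑ t ∈ T', ∫ u in I t, h u := Finset.sum_le_sum fun t _ => hpt t
    _ = ∫ u in ⋃ t ∈ T', I t, h u :=
        (MeasureTheory.integral_biUnion_finset T' (fun _ _ => measurableSet_Ioc) hdisj
          fun t _ => hi hhc t).symm
    _ ≤ ∫ u in ⋃ t ∈ T', I t, Real.exp 1 * (G u * h u) :=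
        MeasureTheory.setIntegral_mono_on
          (MeasureTheory.integrableOn_finset_iUnion.2 fun t _ => hi hhc t)
          hGi.integrableOn hmeas hGe
    _ ≤ ∫ u, Real.exp 1 * (G u * h u) :=
        MeasureTheory.setIntegral_le_integral hGi
          (Filter.Eventually.of_forall fun u => by have := hh0 u; positivity)
    _ = Real.exp 1 * ((1 + W) * (∫ u, G u * ‖f u‖ ^ 2) + W⁻¹ * ∫ u, G u * ‖f' u‖ ^ 2) := by
        rw [hGh, MeasureTheory.integral_const_mul,
          MeasureTheory.integral_add (hintegrable.const_mul _) (hintegrable'.const_mul _),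
          MeasureTheory.integral_const_mul, MeasureTheory.integral_const_mul]
    _ ≤ Real.exp 1 * ((1 + W) * (K * ∑ n ∈ S, ‖c n‖ ^ 2) +
          W⁻¹ * (K * (W ^ 2 * ∑ n ∈ S, ‖c n‖ ^ 2))) := by
        gcongr
        exact hM'.trans (by gcongr)
    _ = _ := by
        rw [hK]
        field_simp
        ring

theorem card_le_factorial_of_prod_eq {k n : ℕ} (A : Finset (Fin k → ℕ))
    (hA : ∀ f ∈ A, (∀ i, (f i).Prime) ∧ ∏ i, f i = n) : A.card ≤ k.factorial := by
  rcases A.eq_empty_or_nonempty with rfl | ⟨f₀, hf₀⟩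
  · simp
  have hperm : ∀ f ∈ A, (List.ofFn f).Perm n.primeFactorsList := fun f hf =>
    Nat.primeFactorsList_unique (by rw [List.prod_ofFn, (hA f hf).2])
      (fun p hp => by
        obtain ⟨i, rfl⟩ := List.mem_ofFn.1 hp
        exact (hA f hf).1 i)
  have hlen : n.primeFactorsList.length = k := by
    rw [← (hperm f₀ hf₀).length_eq, List.length_ofFn]
  calc A.card = (A.image List.ofFn).card :=
        (Finset.card_image_of_injective _ List.ofFn_injective).symm
    _ ≤ n.primeFactorsList.permutations.toFinset.card := by
        refine Finset.card_le_card fun l hl => ?_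
        obtain ⟨f, hf, rfl⟩ := Finset.mem_image.1 hl
        exact List.mem_toFinset.2 (List.mem_permutations.2 (hperm f hf))
    _ ≤ n.primeFactorsList.permutations.length := List.toFinset_card_le _
    _ = k.factorial := by rw [List.length_permutations, hlen]

theorem trigSum_add_const (S : Finset ℕ) (c : ℕ → ℂ) (θ : ℕ → ℝ) (x t : ℝ) :
    ‖trigSum S c (fun n => x + θ n) t‖ = ‖trigSum S c θ t‖ := by
  have h : trigSum S c (fun n => x + θ n) t =
      Complex.exp ((x * t : ℝ) * Complex.I) * trigSum S c θ t := by
    unfold trigSum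
    rw [Finset.mul_sum]
    refine Finset.sum_congr rfl fun n _ => ?_
    rw [mul_left_comm, ← Complex.exp_add]
    congr 2
    push_cast
    ring
  rw [h, norm_mul, Complex.norm_exp_ofReal_mul_I, one_mul]

/-- The set of products of `k` elements of `Q`. -/
noncomputable def productSet (Q : Finset ℕ) (k : ℕ) : Finset ℕ :=
  (Fintype.piFinset fun _ : Fin k => Q).image fun f => ∏ i, f i

/-- The coefficients of the `k`-th Dirichlet power of `c`. -/
noncomputable def powCoeff (Q : Finset ℕ) (c : ℕ → ℂ) (k n : ℕ) : ℂ :=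
  ∑ f ∈ Fintype.piFinset (fun _ : Fin k => Q) with ∏ i, f i = n, ∏ i, c (f i)

theorem trigSum_neg_log_pow (Q : Finset ℕ) (hQ : ∀ p ∈ Q, p.Prime) (c : ℕ → ℂ) (k : ℕ)
    (t : ℝ) :
    trigSum Q c (fun n => -Real.log n) t ^ k =
      trigSum (productSet Q k) (powCoeff Q c k) (fun n => -Real.log n) t := by
  unfold trigSum powCoeff productSet
  rw [Finset.sum_pow', ← Finset.sum_fiberwise_of_maps_to
    (g := fun f : Fin k → ℕ => ∏ i, f i) (fun f hf => Finset.mem_image_of_mem _ hf)]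
  refine Finset.sum_congr rfl fun n _ => ?_
  rw [Finset.sum_mul]
  refine Finset.sum_congr rfl fun f hf => ?_
  obtain ⟨hfp, rfl⟩ := Finset.mem_filter.1 hf
  have hfQ : ∀ i, f i ∈ Q := Fintype.mem_piFinset.1 hfp
  rw [Finset.prod_mul_distrib, ← Complex.exp_sum]
  congr 2
  beta_reduce
  rw [Nat.cast_prod, Real.log_prod fun i _ => Nat.cast_ne_zero.2
    (hQ _ (hfQ i)).ne_zero]
  push_cast
  rw [← Finset.sum_mul, ← Finset.mul_sum, Finset.sum_neg_distrib]

theorem sum_norm_powCoeff_sq_le (Q : Finset ℕ) (hQ : ∀ p ∈ Q, p.Prime) (c : ℕ → ℂ) (k : ℕ) :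
    ∑ n ∈ productSet Q k, ‖powCoeff Q c k n‖ ^ 2 ≤
      k.factorial * (∑ p ∈ Q, ‖c p‖ ^ 2) ^ k := by
  have h : ∀ n, ‖powCoeff Q c k n‖ ^ 2 ≤ k.factorial *
      ∑ f ∈ Fintype.piFinset (fun _ : Fin k => Q) with ∏ i, f i = n, ∏ i, ‖c (f i)‖ ^ 2 := by
    intro n
    have hcard := card_le_factorial_of_prod_eq
      ((Fintype.piFinset fun _ : Fin k => Q).filter fun f => ∏ i, f i = n) (n := n)
      fun f hf => by
        obtain ⟨hf, hn⟩ := Finset.mem_filter.1 hf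
        exact ⟨fun i => hQ _ (Fintype.mem_piFinset.1 hf i), hn⟩
    unfold powCoeff
    calc _ ≤ (∑ f ∈ Fintype.piFinset (fun _ : Fin k => Q) with ∏ i, f i = n,
          ∏ i, ‖c (f i)‖) ^ 2 := by
          gcongr
          refine (norm_sum_le _ _).trans_eq ?_
          simp only [norm_prod]
      _ ≤ _ := sq_sum_le_card_mul_sum_sq
      _ ≤ _ := by
          simp only [← Finset.prod_pow]
          gcongr
  refine (Finset.sum_le_sum fun n _ => h n).trans_eq ?_
  rw [← Finset.mul_sum, productSet, Finset.sum_fiberwise_of_maps_to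
    (g := fun f : Fin k → ℕ => ∏ i, f i) (fun f hf => Finset.mem_image_of_mem _ hf),
    Finset.sum_pow']

theorem div_le_abs_log_sub_log {m n N : ℝ} (hm : 0 < m) (hn : 0 < n) (hmN : m ≤ N)
    (hnN : n ≤ N) : |m - n| / N ≤ |Real.log m - Real.log n| := by
  wlog h : n ≤ m generalizing m n
  · rw [abs_sub_comm m, abs_sub_comm (Real.log m)]
    exact this hn hm hnN hmN (le_of_not_ge h)
  have h1 : 1 - (m / n)⁻¹ ≤ Real.log (m / n) := Real.one_sub_inv_le_log_of_pos (by positivity)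
  rw [Real.log_div hm.ne' hn.ne', inv_div] at h1
  have h2 : (m - n) / N ≤ (m - n) / m := by
    have : 0 ≤ m - n := by linarith
    gcongr
  have h3 : (m - n) / m = 1 - n / m := by field_simp
  rw [abs_of_nonneg (by linarith : 0 ≤ m - n)]
  exact (h2.trans (h3.trans_le h1)).trans (le_abs_self _)

/-- The set of primes in `[P, 2P)`. -/
noncomputable def dyadicPrimes (P : ℝ) : Finset ℕ :=
  (Finset.range ⌈2 * P⌉₊).filter fun p => p.Prime ∧ P ≤ (p : ℝ) ∧ (p : ℝ) < 2 * P

theorem mem_dyadicPrimes {P : ℝ} {p : ℕ} (hp : p ∈ dyadicPrimes P) :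
    p.Prime ∧ P ≤ (p : ℝ) ∧ (p : ℝ) < 2 * P :=
  (Finset.mem_filter.1 hp).2

theorem card_dyadicPrimes_le {P : ℝ} (hP : 1 ≤ P) : ((dyadicPrimes P).card : ℝ) ≤ 2 * P := by
  have h1 : dyadicPrimes P ⊆ Finset.Ico ⌈P⌉₊ ⌈2 * P⌉₊ := fun p hp =>
    Finset.mem_Ico.2 ⟨Nat.ceil_le.2 (mem_dyadicPrimes hp).2.1,
      Nat.lt_ceil.2 (mem_dyadicPrimes hp).2.2⟩
  have h2 := Finset.card_le_card h1
  rw [Nat.card_Ico] at h2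
  have h3 : (((⌈2 * P⌉₊ - ⌈P⌉₊ : ℕ)) : ℝ) = ⌈2 * P⌉₊ - ⌈P⌉₊ :=
    Nat.cast_sub (Nat.ceil_mono (by linarith))
  have h4 := Nat.ceil_lt_add_one (show 0 ≤ 2 * P by linarith)
  have h5 := Nat.le_ceil P
  have h6 : ((dyadicPrimes P).card : ℝ) ≤ ((⌈2 * P⌉₊ - ⌈P⌉₊ : ℕ) : ℝ) := by exact_mod_cast h2
  linarith

theorem primePoly_eq_trigSum (P : ℝ) (a : ℕ → ℂ) (t : ℝ) :
    primePoly P a t =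
      trigSum (dyadicPrimes P) (fun p => a p / p) (fun n => -Real.log n) t := by
  unfold primePoly trigSum dyadicPrimes
  rw [Finset.sum_filter]
  refine Finset.sum_congr rfl fun p _ => ?_
  split_ifs with h
  · beta_reduce
    have hp : (p : ℂ) ≠ 0 := Nat.cast_ne_zero.2 h.1.ne_zero
    rw [neg_add, Complex.cpow_add _ _ hp, Complex.cpow_neg_one, div_eq_mul_inv, mul_assoc,
      Complex.cpow_def_of_ne_zero hp, ← Complex.natCast_log]
    congr 3
    push_cast
    ring
  · rfl

theorem norm_primePoly_le {P : ℝ} (hP : 1 ≤ P) {a : ℕ → ℂ}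
    (ha : ∀ p ∈ dyadicPrimes P, ‖a p‖ ≤ 1) (t : ℝ) : ‖primePoly P a t‖ ≤ 2 := by
  rw [primePoly_eq_trigSum]
  refine (norm_trigSum_le _ _ _ _).trans ?_
  have h : ∀ p ∈ dyadicPrimes P, ‖a p / p‖ ≤ 1 / P := fun p hp => by
    rw [norm_div, Complex.norm_natCast]
    exact div_le_div₀ zero_le_one (ha p hp) (by linarith) (mem_dyadicPrimes hp).2.1
  refine (Finset.sum_le_card_nsmul _ _ _ h).trans ?_
  rw [nsmul_eq_mul, mul_one_div, div_le_iff₀ (by linarith)]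
  exact card_dyadicPrimes_le hP

theorem sum_norm_div_sq_le {P : ℝ} (hP : 1 ≤ P) {a : ℕ → ℂ}
    (ha : ∀ p ∈ dyadicPrimes P, ‖a p‖ ≤ 1) :
    ∑ p ∈ dyadicPrimes P, ‖a p / p‖ ^ 2 ≤ 2 / P := by
  have h : ∀ p ∈ dyadicPrimes P, ‖a p / p‖ ^ 2 ≤ (1 / P) ^ 2 := fun p hp => by
    rw [norm_div, Complex.norm_natCast]
    gcongr
    · exact ha p hp
    · exact (mem_dyadicPrimes hp).2.1
  refine (Finset.sum_le_card_nsmul _ _ _ h).trans ?_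
  rw [nsmul_eq_mul]
  calc _ ≤ 2 * P * (1 / P) ^ 2 := by gcongr; exact card_dyadicPrimes_le hP
    _ = _ := by field_simp

theorem mem_productSet_dyadicPrimes {P : ℝ} (hP : 0 < P) {k n : ℕ}
    (hn : n ∈ productSet (dyadicPrimes P) k) : P ^ k ≤ (n : ℝ) ∧ (n : ℝ) ≤ (2 * P) ^ k := by
  obtain ⟨f, hf, rfl⟩ := Finset.mem_image.1 hn
  have hf := fun i => mem_dyadicPrimes (Fintype.mem_piFinset.1 hf i)
  have h1 : ∏ _i : Fin k, P ≤ ∏ i, (f i : ℝ) :=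
    Finset.prod_le_prod (fun _ _ => hP.le) fun i _ => (hf i).2.1
  have h2 : ∏ i, (f i : ℝ) ≤ ∏ _i : Fin k, (2 * P) :=
    Finset.prod_le_prod (fun _ _ => by positivity) fun i _ => (hf i).2.2.le
  rw [Finset.prod_const, Finset.card_univ, Fintype.card_fin] at h1 h2
  rw [Nat.cast_prod]
  exact ⟨h1, h2⟩

/-- The moment bound underlying the large values estimate. -/
theorem sum_norm_primePoly_pow_le {T P : ℝ} (hT : 1 ≤ T) (hP : 2 ≤ P) {a : ℕ → ℂ}
    (ha : ∀ p ∈ dyadicPrimes P, ‖a p‖ ≤ 1) {k : ℕ} (hk : 1 ≤ k) (hTk : T ≤ P ^ k)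
    (T' : Finset ℝ) (hT' : ∀ t ∈ T', |t| ≤ T)
    (hsep : ∀ t ∈ T', ∀ u ∈ T', t ≠ u → 1 ≤ |t - u|) :
    ∑ t ∈ T', ‖primePoly P a t‖ ^ (2 * k) ≤
      12 * √Real.pi * Real.exp 1 ^ 2 * (8 * k : ℝ) ^ k := by
  have hk1 : (1 : ℝ) ≤ k := by exact_mod_cast hk
  have hPk : 0 < P ^ k := by positivity
  set S := productSet (dyadicPrimes P) k with hS
  have hQ : ∀ p ∈ dyadicPrimes P, p.Prime := fun p hp => (mem_dyadicPrimes hp).1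
  have hmem : ∀ n ∈ S, P ^ k ≤ (n : ℝ) ∧ (n : ℝ) ≤ (2 * P) ^ k := fun n hn =>
    mem_productSet_dyadicPrimes (by linarith) hn
  have hpos : ∀ n ∈ S, (0 : ℝ) < n := fun n hn => hPk.trans_le (hmem n hn).1
  have h := sum_trigSum_sq_le S (powCoeff (dyadicPrimes P) (fun p => a p / p) k)
    (fun n => Real.log (P ^ k) + -Real.log n) (N := (2 * P) ^ k) (R := T + 1 / 2) (W := k)
    (by positivity) (by linarith) (by linarith)
    (fun m hm n hn => by
      rw [show Real.log (P ^ k) + -Real.log m - (Real.log (P ^ k) + -Real.log n) =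
        Real.log n - Real.log m by ring, abs_sub_comm (Real.log n)]
      exact div_le_abs_log_sub_log (hpos m hm) (hpos n hn) (hmem m hm).2 (hmem n hn).2)
    (fun n hn => by
      have h1 := Real.log_le_log hPk (hmem n hn).1
      have h2 := Real.log_le_log (hpos n hn) (hmem n hn).2
      rw [mul_pow, Real.log_mul (by positivity) hPk.ne', Real.log_pow 2] at h2
      have h3 : (k : ℝ) * Real.log 2 ≤ k * 1 := by
        gcongr
        linarith [Real.log_two_lt_d9]
      exact abs_le.2 ⟨by linarith, by linarith⟩)
    T' (fun t ht => by linarith [hT' t ht]) hsep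
  have hF : ∀ t, ‖primePoly P a t‖ ^ (2 * k) = ‖trigSum S
      (powCoeff (dyadicPrimes P) (fun p => a p / p) k)
      (fun n => Real.log (P ^ k) + -Real.log n) t‖ ^ 2 := fun t => by
    rw [trigSum_add_const, ← trigSum_neg_log_pow _ hQ, ← primePoly_eq_trigSum, norm_pow,
      ← pow_mul, mul_comm]
  simp_rw [hF]
  refine h.trans ?_
  have hc : ∑ n ∈ S, ‖powCoeff (dyadicPrimes P) (fun p => a p / p) k n‖ ^ 2 ≤
      (k : ℝ) ^ k * (2 / P) ^ k := by
    refine (sum_norm_powCoeff_sq_le _ hQ _ k).trans ?_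
    gcongr
    · exact_mod_cast Nat.factorial_le_pow k
    · exact sum_norm_div_sq_le (by linarith) ha
  have h2k : (k : ℝ) + 1 ≤ 2 ^ k := by exact_mod_cast Nat.lt_two_pow_self (n := k)
  have hW : 1 + 2 * (k : ℝ) ≤ 3 * 2 ^ k := by linarith
  have hR : T + 1 / 2 + (2 * P) ^ k ≤ 2 * (2 ^ k * P ^ k) := by
    rw [mul_pow]
    nlinarith
  calc _ ≤ 2 * √Real.pi * Real.exp 1 ^ 2 * (3 * 2 ^ k) * (2 * (2 ^ k * P ^ k)) *
        ((k : ℝ) ^ k * (2 / P) ^ k) := by gcongr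
    _ = _ := by
        rw [div_pow, mul_pow, show (8 : ℝ) = 2 * 2 * 2 by norm_num, mul_pow, mul_pow]
        field_simp
        ring

theorem exists_pow_ceil_le (δ : ℝ) (hδ : 0 < δ) :
    ∃ C : ℝ, 0 < C ∧ ∀ L x : ℝ, 1 ≤ L → 0 < x → x ≤ 2 * L →
      (8 * ⌈x⌉₊ : ℝ) ^ ⌈x⌉₊ ≤ C * Real.exp ((1 + δ) * x * Real.log L) := by
  set y := max (2 / δ) (2 * Real.exp (2 / δ * Real.log 24)) with hy
  set K := ⌈y⌉₊ with hK
  have hy0 : 0 < y := lt_max_of_lt_left (by positivity)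
  have hK1 : 1 ≤ K := Nat.ceil_pos.2 hy0
  have hK1' : (1 : ℝ) ≤ K := by exact_mod_cast hK1
  refine ⟨(8 * K : ℝ) ^ K + 24, by positivity, fun L x hL hx hxL => ?_⟩
  have hlogL : 0 ≤ Real.log L := Real.log_nonneg hL
  rcases le_or_gt x y with hxy | hxy
  · have h1 : ⌈x⌉₊ ≤ K := Nat.ceil_mono hxy
    have h2 : 1 ≤ Real.exp ((1 + δ) * x * Real.log L) := Real.one_le_exp (by positivity)
    calc (8 * ⌈x⌉₊ : ℝ) ^ ⌈x⌉₊ ≤ (8 * K : ℝ) ^ ⌈x⌉₊ := by gcongr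
      _ ≤ (8 * K : ℝ) ^ K := pow_le_pow_right₀ (by linarith) h1
      _ ≤ ((8 * K : ℝ) ^ K + 24) * 1 := by linarith
      _ ≤ _ := by gcongr
  · have hx1 : 2 / δ < x := (le_max_left _ _).trans_lt hxy
    have hx2 : 2 * Real.exp (2 / δ * Real.log 24) < x := (le_max_right _ _).trans_lt hxy
    have hk := Nat.ceil_lt_add_one hx.le
    have hL2 : 2 / δ * Real.log 24 ≤ Real.log L := by
      rw [Real.le_log_iff_exp_le (by linarith)]
      linarith
    have h1 : 1 ≤ δ * x / 2 := by
      rw [div_lt_iff₀ hδ] at hx1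
      linarith
    have h2 : Real.log L ≤ δ * x / 2 * Real.log L := by nlinarith
    have h3 : x * Real.log 24 ≤ δ * x / 2 * Real.log L := by
      have := mul_le_mul_of_nonneg_left hL2 (show 0 ≤ δ * x / 2 by positivity)
      calc x * Real.log 24 = δ * x / 2 * (2 / δ * Real.log 24) := by field_simp
        _ ≤ _ := this
    have h24 : 0 ≤ Real.log 24 := Real.log_nonneg (by norm_num)
    calc (8 * ⌈x⌉₊ : ℝ) ^ ⌈x⌉₊ ≤ (24 * L) ^ ⌈x⌉₊ := by
          gcongr ?_ ^ _
          linarith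
      _ = Real.exp (⌈x⌉₊ * (Real.log 24 + Real.log L)) := by
          rw [← Real.log_mul (by norm_num) (by linarith), Real.exp_nat_mul,
            Real.exp_log (by positivity)]
      _ ≤ Real.exp (Real.log 24 + (1 + δ) * x * Real.log L) := by
          apply Real.exp_le_exp.2
          have : ⌈x⌉₊ * (Real.log 24 + Real.log L) ≤ (x + 1) * (Real.log 24 + Real.log L) := by
            gcongr
          linarith
      _ = 24 * Real.exp ((1 + δ) * x * Real.log L) := by
          rw [Real.exp_add, Real.exp_log (by norm_num)]
      _ ≤ _ := by
          gcongr
          linarith [show 0 ≤ (8 * K : ℝ) ^ K by positivity]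

/-- Lemma 7: a large values estimate for Dirichlet polynomials supported on primes. -/
theorem large_values_prime_poly (δ : ℝ) (hδ : 0 < δ) :
    ∃ Cδ : ℝ, 0 < Cδ ∧
    ∀ T P V : ℝ, 3 ≤ T → 2 ≤ P → 0 < V →
    ∀ a : ℕ → ℂ, (∀ p : ℕ, p.Prime → P ≤ (p : ℝ) → (p : ℝ) < 2 * P → ‖a p‖ ≤ 1) →
    ∀ T' : Finset ℝ, (↑T' ⊆ Set.Icc (-T) T) →
      (∀ t ∈ T', ∀ u ∈ T', t ≠ u → 1 ≤ |t - u|) →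
      (∀ t ∈ T', V ≤ ‖primePoly P a t‖) →
      (T'.card : ℝ) ≤ Cδ * T ^ (2 * Real.log (1 / V) / Real.log P) * (1 / V ^ 2) *
        Real.exp ((1 + δ) * (Real.log T / Real.log P) * Real.log (Real.log T)) := by
  obtain ⟨C, hC0, hC⟩ := exists_pow_ceil_le δ hδ
  set D := 12 * √Real.pi * Real.exp 1 ^ 2 with hD
  have hD0 : 0 < D := by positivity
  refine ⟨4 * D * C, by positivity, fun T P V hT hP hV a ha T' hT' hsep hbig => ?_⟩
  rcases T'.eq_empty_or_nonempty with rfl | ⟨t₀, ht₀⟩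
  · simp only [Finset.card_empty, Nat.cast_zero]
    positivity
  have ha' : ∀ p ∈ dyadicPrimes P, ‖a p‖ ≤ 1 := fun p hp =>
    ha p (mem_dyadicPrimes hp).1 (mem_dyadicPrimes hp).2.1 (mem_dyadicPrimes hp).2.2
  have hV2 : V ≤ 2 := (hbig t₀ ht₀).trans (norm_primePoly_le (by linarith) ha' t₀)
  have hL1 : 1 ≤ Real.log T := by
    rw [Real.le_log_iff_exp_le (by linarith)]
    linarith [Real.exp_one_lt_d9]
  have hP1 : 1 / 2 ≤ Real.log P :=
    (by linarith [Real.log_two_gt_d9] : 1 / 2 ≤ Real.log 2).trans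
      (Real.log_le_log (by norm_num) hP)
  have hP0 : 0 < Real.log P := by linarith
  set x := Real.log T / Real.log P with hx
  have hx0 : 0 < x := by positivity
  have hxP : x * Real.log P = Real.log T := by rw [hx]; field_simp
  have hx2 : x ≤ 2 * Real.log T := by nlinarith
  set k := ⌈x⌉₊ with hk
  have hk1 : 1 ≤ k := Nat.ceil_pos.2 hx0
  have hxk : x ≤ k := Nat.le_ceil x
  have hkx : (k : ℝ) < x + 1 := Nat.ceil_lt_add_one hx0.le
  have hTk : T ≤ P ^ k := by
    rw [← Real.log_le_log_iff (by linarith) (by positivity), Real.log_pow, ← hxP]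
    gcongr
  have hmom := sum_norm_primePoly_pow_le (by linarith) hP ha' hk1 hTk T'
    (fun t ht => abs_le.2 (hT' ht)) hsep
  have hcard : (T'.card : ℝ) * V ^ (2 * k) ≤ D * (C * Real.exp ((1 + δ) * x *
      Real.log (Real.log T))) := by
    calc (T'.card : ℝ) * V ^ (2 * k) ≤ ∑ t ∈ T', ‖primePoly P a t‖ ^ (2 * k) := by
          rw [← nsmul_eq_mul]
          refine Finset.card_nsmul_le_sum _ _ _ fun t ht => ?_
          have := hbig t ht
          gcongr
      _ ≤ D * (8 * k : ℝ) ^ k := hmom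
      _ ≤ _ := by
          gcongr
          exact hC _ _ hL1 hx0 hx2
  have hVk : 1 / V ^ (2 * k) ≤
      4 * (T ^ (2 * Real.log (1 / V) / Real.log P) * (1 / V ^ 2)) := by
    have e1 : 1 / V ^ (2 * k) = Real.exp (-(2 * k * Real.log V)) := by
      rw [Real.exp_neg, one_div]
      congr 1
      rw [show 2 * (k : ℝ) * Real.log V = ((2 * k : ℕ) : ℝ) * Real.log V by push_cast; ring,
        Real.exp_nat_mul, Real.exp_log hV]
    have e2 : T ^ (2 * Real.log (1 / V) / Real.log P) = Real.exp (-(2 * x * Real.log V)) := by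
      rw [Real.rpow_def_of_pos (by linarith), one_div, Real.log_inv, hx]
      congr 1
      ring
    have e3 : 1 / V ^ 2 = Real.exp (-(2 * Real.log V)) := by
      rw [Real.exp_neg, one_div]
      congr 1
      rw [show 2 * Real.log V = ((2 : ℕ) : ℝ) * Real.log V by norm_num,
        Real.exp_nat_mul, Real.exp_log hV]
    have e4 : (4 : ℝ) = Real.exp (2 * Real.log 2) := by
      rw [show 2 * Real.log 2 = ((2 : ℕ) : ℝ) * Real.log 2 by norm_num,
        Real.exp_nat_mul, Real.exp_log (by norm_num)]
      norm_num
    rw [e1, e2, e3, e4, ← Real.exp_add, ← Real.exp_add]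
    apply Real.exp_le_exp.2
    have h1 : Real.log V ≤ Real.log 2 := Real.log_le_log hV hV2
    have h2 : (x + 1 - k) * Real.log V ≤ (x + 1 - k) * Real.log 2 := by
      gcongr
    have h3 : (x + 1 - k) * Real.log 2 ≤ 1 * Real.log 2 := by
      have := Real.log_nonneg (one_le_two (α := ℝ))
      nlinarith
    linarith
  calc (T'.card : ℝ) = T'.card * V ^ (2 * k) * (1 / V ^ (2 * k)) := by field_simp
    _ ≤ D * (C * Real.exp ((1 + δ) * x * Real.log (Real.log T))) *
        (4 * (T ^ (2 * Real.log (1 / V) / Real.log P) * (1 / V ^ 2))) := by gcongr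
    _ = _ := by ring
end
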